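/- arXiv:2407.09703 — 6 statements merged into one kernel-verified Lean document; each statement's English description precedes it below -/
import Mathlib

section
/- There exists a constant C > 0, depending only on H, such that for every integer n ≥ 1 the matrix P^(n) is invertible and the spectral norm of its inverse satisfies ‖(P^(n))^{-1}‖₂ ≤ C · n^β, where β = max{1, 2H}. -/
open MeasureTheory

/-- The covariance matrix of fractional Gaussian noise with Hurst parameter `H`
on the equispaced grid of mesh `δ = 1/n` on `[0,1]`. -/
noncomputable def fgnCov (H : ℝ) (n : ℕ) : Matrix (Fin n) (Fin n) ℝ :=
  fun i j =>
    ((1 / (n : ℝ)) ^ (2 * H) / 2) *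
      ((|(i : ℝ) - (j : ℝ)| + 1) ^ (2 * H) + abs (|(i : ℝ) - (j : ℝ)| - 1) ^ (2 * H)
        - 2 * |(i : ℝ) - (j : ℝ)| ^ (2 * H))

/-- The spectral norm of a real square matrix: the operator norm induced by the
Euclidean norm. -/
noncomputable def specNorm {n : ℕ} (A : Matrix (Fin n) (Fin n) ℝ) : ℝ :=
  ‖Matrix.toEuclideanCLM (𝕜 := ℝ) A‖

open MeasureTheory Set

noncomputable def fgnG (H t : ℝ) : ℝ := (1 - Real.cos t) * t ^ (-1 - 2 * H)

noncomputable def fgnI (H : ℝ) : ℝ := ∫ t in Ioi (0:ℝ), fgnG H t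

lemma fgnG_nonneg (H t : ℝ) (ht : 0 < t) : 0 ≤ fgnG H t :=
  mul_nonneg (by linarith [Real.cos_le_one t]) (Real.rpow_nonneg ht.le _)

lemma fgnG_meas (H : ℝ) : Measurable (fgnG H) := by
  unfold fgnG
  fun_prop

lemma fgnG_integrable (H : ℝ) (hH0 : 0 < H) (hH1 : H < 1) :
    IntegrableOn (fgnG H) (Ioi 0) := by
  rw [← Ioc_union_Ioi_eq_Ioi (zero_le_one' ℝ)]
  apply IntegrableOn.union
  · have h1 : IntegrableOn (fun t : ℝ => t ^ (1 - 2 * H)) (Ioc 0 1) := by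
      rw [← intervalIntegrable_iff_integrableOn_Ioc_of_le zero_le_one]
      exact intervalIntegral.intervalIntegrable_rpow' (by linarith)
    refine Integrable.mono' h1 (fgnG_meas H).aestronglyMeasurable ?_
    refine (ae_restrict_iff' measurableSet_Ioc).2 (Filter.Eventually.of_forall ?_)
    intro t ht
    rw [Real.norm_of_nonneg (fgnG_nonneg H t ht.1)]
    unfold fgnG
    have e : t ^ (1 - 2 * H) = t ^ 2 * t ^ (-1 - 2 * H) := by
      rw [← Real.rpow_natCast t 2, ← Real.rpow_add ht.1]
      congr 1; push_cast; ring
    rw [e]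
    apply mul_le_mul_of_nonneg_right _ (Real.rpow_nonneg ht.1.le _)
    nlinarith [Real.one_sub_sq_div_two_le_cos (x := t), sq_nonneg t]
  · have h1 : IntegrableOn (fun t : ℝ => 2 * t ^ (-1 - 2 * H)) (Ioi 1) :=
      (integrableOn_Ioi_rpow_of_lt (by linarith) one_pos).const_mul 2
    refine Integrable.mono' h1 (fgnG_meas H).aestronglyMeasurable ?_
    refine (ae_restrict_iff' measurableSet_Ioi).2 (Filter.Eventually.of_forall ?_)
    intro t ht
    have ht0 : 0 < t := lt_trans one_pos ht
    rw [Real.norm_of_nonneg (fgnG_nonneg H t ht0)]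
    unfold fgnG
    apply mul_le_mul_of_nonneg_right _ (Real.rpow_nonneg ht0.le _)
    linarith [Real.neg_one_le_cos t]

lemma fgn_scale_eq (H x t : ℝ) (hx : 0 < x) (ht : 0 < t) :
    (1 - Real.cos (x * t)) * t ^ (-1 - 2 * H) = x ^ (1 + 2 * H) * fgnG H (x * t) := by
  unfold fgnG
  rw [Real.mul_rpow hx.le ht.le]
  have : x ^ (1 + 2 * H) * x ^ (-1 - 2 * H) = 1 := by
    rw [← Real.rpow_add hx, show 1 + 2 * H + (-1 - 2 * H) = 0 by ring, Real.rpow_zero]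
  linear_combination (-(1 - Real.cos (x * t)) * t ^ (-1 - 2 * H)) * this

lemma fgn_scale (H : ℝ) (hH0 : 0 < H) (hH1 : H < 1) (x : ℝ) (hx : 0 ≤ x) :
    IntegrableOn (fun t => (1 - Real.cos (x * t)) * t ^ (-1 - 2 * H)) (Ioi 0) ∧
    ∫ t in Ioi (0:ℝ), (1 - Real.cos (x * t)) * t ^ (-1 - 2 * H) = x ^ (2 * H) * fgnI H := by
  rcases hx.eq_or_lt with rfl | hx
  · simp [Real.zero_rpow (show 2 * H ≠ 0 by positivity)]
  constructor
  · have h : IntegrableOn (fun t => x ^ (1 + 2 * H) * fgnG H (x * t)) (Ioi 0) := by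
      apply Integrable.const_mul
      have := (integrableOn_Ioi_comp_mul_left_iff (fgnG H) 0 hx).2
        (by simpa using fgnG_integrable H hH0 hH1)
      exact this
    exact h.congr_fun (fun t ht => (fgn_scale_eq H x t hx ht).symm) measurableSet_Ioi
  · rw [setIntegral_congr_fun measurableSet_Ioi (fun t ht => fgn_scale_eq H x t hx ht),
      integral_const_mul, integral_comp_mul_left_Ioi (fgnG H) 0 hx, mul_zero, smul_eq_mul,
      Real.rpow_add hx, Real.rpow_one, fgnI]
    field_simp

lemma fgn_gamma (H : ℝ) (hH0 : 0 < H) (hH1 : H < 1) (k : ℝ) :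
    IntegrableOn (fun t => Real.cos (k * t) * fgnG H t) (Ioi 0) ∧
    ∫ t in Ioi (0:ℝ), Real.cos (k * t) * fgnG H t =
      fgnI H * (((|k| + 1) ^ (2 * H) + abs (|k| - 1) ^ (2 * H) - 2 * |k| ^ (2 * H)) / 2) := by
  obtain ⟨i1, e1⟩ := fgn_scale H hH0 hH1 (|k| + 1) (by positivity)
  obtain ⟨i2, e2⟩ := fgn_scale H hH0 hH1 (abs (|k| - 1)) (by positivity)
  obtain ⟨i3, e3⟩ := fgn_scale H hH0 hH1 (|k|) (by positivity)
  have key : ∀ t : ℝ, Real.cos (k * t) * fgnG H t =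
      (1 / 2) * (((1 - Real.cos ((|k| + 1) * t)) * t ^ (-1 - 2 * H) +
      (1 - Real.cos (abs (|k| - 1) * t)) * t ^ (-1 - 2 * H)) -
      2 * ((1 - Real.cos (|k| * t)) * t ^ (-1 - 2 * H))) := by
    intro t
    have a1 : Real.cos (abs (|k| - 1) * t) = Real.cos ((|k| - 1) * t) := by
      rcases abs_choice (|k| - 1) with h | h <;> rw [h]
      rw [neg_mul, Real.cos_neg]
    have a2 : Real.cos (|k| * t) = Real.cos (k * t) := by
      rcases abs_choice k with h | h <;> rw [h]
      rw [neg_mul, Real.cos_neg]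
    rw [a1, ← a2, add_mul |k| 1 t, sub_mul |k| 1 t, Real.cos_add, Real.cos_sub, one_mul, fgnG]
    ring
  simp_rw [key]
  refine ⟨((i1.add i2).sub (i3.const_mul 2)).const_mul _, ?_⟩
  have s1 := integral_sub (i1.add i2) (i3.const_mul 2)
  have s2 := integral_add i1 i2
  simp only [Pi.add_apply] at s1 s2
  rw [integral_const_mul, s1, s2, integral_const_mul, e1, e2, e3]
  ring

noncomputable def fgnS {n : ℕ} (x : Fin n → ℝ) (t : ℝ) : ℝ :=
  (∑ i, x i * Real.cos (i * t)) ^ 2 + (∑ i, x i * Real.sin (i * t)) ^ 2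

lemma fgnS_eq {n : ℕ} (x : Fin n → ℝ) (t : ℝ) :
    fgnS x t = ∑ i, ∑ j, x i * x j * Real.cos (((i:ℝ) - (j:ℝ)) * t) := by
  unfold fgnS
  rw [sq, sq, Finset.sum_mul_sum, Finset.sum_mul_sum, ← Finset.sum_add_distrib]
  refine Finset.sum_congr rfl fun i _ => ?_
  rw [← Finset.sum_add_distrib]
  refine Finset.sum_congr rfl fun j _ => ?_
  rw [sub_mul, Real.cos_sub]; ring

lemma fgnS_nonneg {n : ℕ} (x : Fin n → ℝ) (t : ℝ) : 0 ≤ fgnS x t := by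
  unfold fgnS; positivity

lemma fgnS_cont {n : ℕ} (x : Fin n → ℝ) : Continuous (fgnS x) := by
  unfold fgnS; fun_prop

lemma fgnS_le {n : ℕ} (x : Fin n → ℝ) (t : ℝ) : fgnS x t ≤ n * ∑ i, x i ^ 2 := by
  unfold fgnS
  have h1 := sq_sum_le_card_mul_sum_sq (s := Finset.univ) (f := fun i : Fin n => x i * Real.cos (i * t))
  have h2 := sq_sum_le_card_mul_sum_sq (s := Finset.univ) (f := fun i : Fin n => x i * Real.sin (i * t))
  refine (add_le_add h1 h2).trans (le_of_eq ?_)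
  rw [← mul_add, ← Finset.sum_add_distrib]
  simp only [Finset.card_univ, Fintype.card_fin]
  congr 1
  refine Finset.sum_congr rfl fun i _ => ?_
  linear_combination x i ^ 2 * Real.cos_sq_add_sin_sq (i * t)

lemma fgn_cos_int (k : ℤ) : ∫ t in (0:ℝ)..Real.pi, Real.cos (k * t) = if k = 0 then Real.pi else 0 := by
  split_ifs with h
  · simp [h]
  · have : (k:ℝ) ≠ 0 := by exact_mod_cast h
    rw [intervalIntegral.integral_comp_mul_left (fun t => Real.cos t) this, integral_cos]
    simp [Real.sin_int_mul_pi]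

lemma fgnS_int {n : ℕ} (x : Fin n → ℝ) :
    ∫ t in (0:ℝ)..Real.pi, fgnS x t = Real.pi * ∑ i, x i ^ 2 := by
  simp_rw [fgnS_eq]
  rw [intervalIntegral.integral_finsetSum
    (fun i _ => Continuous.intervalIntegrable (by fun_prop) _ _), Finset.mul_sum]
  refine Finset.sum_congr rfl fun i _ => ?_
  rw [intervalIntegral.integral_finsetSum
    (fun i _ => Continuous.intervalIntegrable (by fun_prop) _ _)]
  have : ∀ j : Fin n, ∫ t in (0:ℝ)..Real.pi, x i * x j * Real.cos (((i:ℝ) - (j:ℝ)) * t) =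
      if i = j then Real.pi * x i ^ 2 else 0 := by
    intro j
    rw [intervalIntegral.integral_const_mul]
    have := fgn_cos_int ((i:ℤ) - (j:ℤ))
    push_cast at this
    rw [this]
    by_cases h : i = j
    · subst h; simp; ring
    · have h' : ((i:ℤ) - (j:ℤ)) ≠ 0 := by
        intro h2; apply h; ext; omega
      simp [h, h']
  simp [this]

lemma fgn_weight (H : ℝ) (hH0 : 0 < H) (hH1 : H < 1) (n : ℕ) (hn : 1 ≤ n) (t : ℝ)
    (ht : t ∈ Icc (1 / (n:ℝ)) Real.pi) :
    2 / Real.pi ^ 3 * (n:ℝ) ^ (2 * H - max 1 (2 * H)) ≤ fgnG H t := by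
  have hn0 : (0:ℝ) < n := by exact_mod_cast hn
  have ht0 : 0 < t := lt_of_lt_of_le (by positivity) ht.1
  have hpi := Real.pi_pos
  have h1 : 2 / Real.pi ^ 2 * t ^ 2 ≤ 1 - Real.cos t := by
    have := Real.cos_le_one_sub_mul_cos_sq (x := t) (by rw [abs_of_pos ht0]; exact ht.2)
    linarith
  have h2 : Real.pi⁻¹ * (n:ℝ) ^ (2 * H - max 1 (2 * H)) ≤ t ^ (1 - 2 * H) := by
    rcases le_total 1 (2 * H) with h | h
    · rw [max_eq_right h, sub_self, Real.rpow_zero, mul_one]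
      calc Real.pi⁻¹ = Real.pi ^ (-1 : ℝ) := (Real.rpow_neg_one _).symm
        _ ≤ Real.pi ^ (1 - 2 * H) := 
          Real.rpow_le_rpow_of_exponent_le (by linarith [Real.pi_gt_three]) (by linarith)
        _ ≤ t ^ (1 - 2 * H) := Real.rpow_le_rpow_of_nonpos ht0 ht.2 (by linarith)
    · rw [max_eq_left h]
      calc Real.pi⁻¹ * (n:ℝ) ^ (2 * H - 1) ≤ 1 * (n:ℝ) ^ (2 * H - 1) := by
            gcongr
            exact inv_le_one_of_one_le₀ (by linarith [Real.pi_gt_three])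
        _ = (1 / (n:ℝ)) ^ (1 - 2 * H) := by
            rw [one_mul, one_div, Real.inv_rpow hn0.le, ← Real.rpow_neg hn0.le]; congr 1; ring
        _ ≤ t ^ (1 - 2 * H) := Real.rpow_le_rpow (by positivity) ht.1 (by linarith)
  unfold fgnG
  have e : t ^ (1 - 2 * H) = t ^ 2 * t ^ (-1 - 2 * H) := by
    rw [← Real.rpow_natCast t 2, ← Real.rpow_add ht0]
    congr 1; push_cast; ring
  calc 2 / Real.pi ^ 3 * (n:ℝ) ^ (2 * H - max 1 (2 * H))
      = 2 / Real.pi ^ 2 * (Real.pi⁻¹ * (n:ℝ) ^ (2 * H - max 1 (2 * H))) := by field_simp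
    _ ≤ 2 / Real.pi ^ 2 * t ^ (1 - 2 * H) := by gcongr
    _ = (2 / Real.pi ^ 2 * t ^ 2) * t ^ (-1 - 2 * H) := by rw [e]; ring
    _ ≤ _ := by gcongr

lemma fgnS_int_ge {n : ℕ} (hn : 1 ≤ n) (x : Fin n → ℝ) :
    2 * ∑ i, x i ^ 2 ≤ ∫ t in (1 / (n:ℝ))..Real.pi, fgnS x t := by
  have hn0 : (0:ℝ) < n := by exact_mod_cast hn
  have h := intervalIntegral.integral_add_adjacent_intervals
    ((fgnS_cont x).intervalIntegrable (μ := volume) 0 (1 / (n:ℝ)))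
    ((fgnS_cont x).intervalIntegrable (1 / (n:ℝ)) Real.pi)
  rw [fgnS_int] at h
  have h2 : ∫ t in (0:ℝ)..(1 / (n:ℝ)), fgnS x t ≤ ∑ i, x i ^ 2 := by
    calc ∫ t in (0:ℝ)..(1 / (n:ℝ)), fgnS x t ≤ ∫ t in (0:ℝ)..(1 / (n:ℝ)), (n * ∑ i, x i ^ 2 : ℝ) :=
          intervalIntegral.integral_mono_on (by positivity)
            ((fgnS_cont x).intervalIntegrable _ _) (by simp) (fun t _ => fgnS_le x t)
      _ = _ := by simp; field_simp
  have h3 : 0 ≤ ∑ i, x i ^ 2 := by positivity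
  nlinarith [Real.pi_gt_three]

lemma fgn_form (H : ℝ) (hH0 : 0 < H) (hH1 : H < 1) (n : ℕ) (hn : 1 ≤ n) (x : Fin n → ℝ) :
    4 / Real.pi ^ 3 * (n:ℝ) ^ (2 * H - max 1 (2 * H)) * ∑ i, x i ^ 2 ≤
    fgnI H * ∑ i : Fin n, ∑ j : Fin n, x i * x j * (((|(i:ℝ) - (j:ℝ)| + 1) ^ (2 * H) +
      abs (|(i:ℝ) - (j:ℝ)| - 1) ^ (2 * H) - 2 * |(i:ℝ) - (j:ℝ)| ^ (2 * H)) / 2) := by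
  have hn0 : (0:ℝ) < n := by exact_mod_cast hn
  have hle : 1 / (n:ℝ) ≤ Real.pi := by
    have : 1 / (n:ℝ) ≤ 1 := by
      rw [div_le_one hn0]; exact_mod_cast hn
    linarith [Real.pi_gt_three]
  have hInt : ∀ i j : Fin n, IntegrableOn (fun t => x i * x j *
      (Real.cos (((i:ℝ) - (j:ℝ)) * t) * fgnG H t)) (Ioi 0) := fun i j =>
    (fgn_gamma H hH0 hH1 _).1.const_mul _
  have hS : ∀ t, fgnS x t * fgnG H t =
      ∑ i, ∑ j, x i * x j * (Real.cos (((i:ℝ) - (j:ℝ)) * t) * fgnG H t) := by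
    intro t
    rw [fgnS_eq, Finset.sum_mul]
    refine Finset.sum_congr rfl fun i _ => ?_
    rw [Finset.sum_mul]
    exact Finset.sum_congr rfl fun j _ => by ring
  have hSint : IntegrableOn (fun t => fgnS x t * fgnG H t) (Ioi 0) := by
    simp_rw [hS]
    exact integrable_finsetSum _ fun i _ => integrable_finsetSum _ fun j _ => hInt i j
  have hval : ∫ t in Ioi (0:ℝ), fgnS x t * fgnG H t = 
    fgnI H * ∑ i : Fin n, ∑ j : Fin n, x i * x j * (((|(i:ℝ) - (j:ℝ)| + 1) ^ (2 * H) +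
      abs (|(i:ℝ) - (j:ℝ)| - 1) ^ (2 * H) - 2 * |(i:ℝ) - (j:ℝ)| ^ (2 * H)) / 2) := by
    simp_rw [hS]
    rw [integral_finsetSum _ fun i _ => integrable_finsetSum _ fun j _ => hInt i j,
      Finset.mul_sum]
    refine Finset.sum_congr rfl fun i _ => ?_
    rw [integral_finsetSum _ fun j _ => hInt i j, Finset.mul_sum]
    refine Finset.sum_congr rfl fun j _ => ?_
    rw [integral_const_mul, (fgn_gamma H hH0 hH1 _).2]
    ring
  rw [← hval]
  have hsub : Ioc (1 / (n:ℝ)) Real.pi ⊆ Ioi 0 := fun t ht =>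
    lt_trans (by positivity : (0:ℝ) < 1 / n) ht.1
  calc 4 / Real.pi ^ 3 * (n:ℝ) ^ (2 * H - max 1 (2 * H)) * ∑ i, x i ^ 2
      = 2 / Real.pi ^ 3 * (n:ℝ) ^ (2 * H - max 1 (2 * H)) * (2 * ∑ i, x i ^ 2) := by ring
    _ ≤ 2 / Real.pi ^ 3 * (n:ℝ) ^ (2 * H - max 1 (2 * H)) *
        ∫ t in (1 / (n:ℝ))..Real.pi, fgnS x t := by
          have := Real.pi_pos
          gcongr
          exact fgnS_int_ge hn x
    _ = ∫ t in Ioc (1 / (n:ℝ)) Real.pi,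
        2 / Real.pi ^ 3 * (n:ℝ) ^ (2 * H - max 1 (2 * H)) * fgnS x t := by
          rw [integral_const_mul, intervalIntegral.integral_of_le hle]
    _ ≤ ∫ t in Ioc (1 / (n:ℝ)) Real.pi, fgnS x t * fgnG H t := by
          refine setIntegral_mono_on ?_ (hSint.mono_set hsub) measurableSet_Ioc ?_
          · exact ((((fgnS_cont x).intervalIntegrable _ _).1).const_mul _)
          · intro t ht
            rw [mul_comm]
            exact mul_le_mul_of_nonneg_left
              (fgn_weight H hH0 hH1 n hn t (Ioc_subset_Icc_self ht)) (fgnS_nonneg x t)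
    _ ≤ _ := by
          refine setIntegral_mono_set hSint ?_ hsub.eventuallyLE
          refine (ae_restrict_iff' measurableSet_Ioi).2 (Filter.Eventually.of_forall ?_)
          intro t ht
          exact mul_nonneg (fgnS_nonneg x t) (fgnG_nonneg H t ht)

lemma fgnI_pos (H : ℝ) (hH0 : 0 < H) (hH1 : H < 1) : 0 < fgnI H := by
  have := fgn_form H hH0 hH1 1 le_rfl (fun _ => 1)
  have h2 : (0:ℝ) < 4 / Real.pi ^ 3 := by have := Real.pi_pos; positivity
  simp [Real.zero_rpow (show 2 * H ≠ 0 by positivity)] at this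
  linarith

open Matrix in
lemma specNorm_inv_le {n : ℕ} (A : Matrix (Fin n) (Fin n) ℝ) (c : ℝ) (hc : 0 < c)
    (h : ∀ x : Fin n → ℝ, c * ∑ i, x i ^ 2 ≤ x ⬝ᵥ (A *ᵥ x)) :
    IsUnit A ∧ ‖Matrix.toEuclideanCLM (𝕜 := ℝ) A⁻¹‖ ≤ c⁻¹ := by
  have hu : IsUnit A := by
    rw [← Matrix.mulVec_injective_iff_isUnit]
    rw [← Matrix.coe_mulVecLin, ← LinearMap.ker_eq_bot, LinearMap.ker_eq_bot']
    intro x hx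
    have := h x
    rw [Matrix.mulVecLin_apply] at hx
    rw [hx, dotProduct_zero] at this
    have h0 : ∑ i, x i ^ 2 = 0 := le_antisymm (by nlinarith) (by positivity)
    rw [Finset.sum_eq_zero_iff_of_nonneg (fun i _ => sq_nonneg _)] at h0
    funext i
    simpa using h0 i (Finset.mem_univ i)
  refine ⟨hu, ContinuousLinearMap.opNorm_le_bound _ (by positivity) fun y => ?_⟩
  set z := Matrix.toEuclideanCLM (𝕜 := ℝ) A⁻¹ y with hz
  have hz' : z.ofLp = A⁻¹ *ᵥ y.ofLp := by rw [hz, Matrix.ofLp_toEuclideanCLM]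
  have hA : A *ᵥ z.ofLp = y.ofLp := by
    rw [hz', Matrix.mulVec_mulVec, Matrix.mul_nonsing_inv _ ((Matrix.isUnit_iff_isUnit_det _).1 hu),
      Matrix.one_mulVec]
  have h1 := h z.ofLp
  rw [hA] at h1
  have h2 : z.ofLp ⬝ᵥ y.ofLp = inner ℝ z y := by
    simp [dotProduct, PiLp.inner_apply, mul_comm]
  have h3 : ∑ i, z.ofLp i ^ 2 = ‖z‖ ^ 2 := by
    simp [EuclideanSpace.norm_sq_eq]
  rw [h2, h3] at h1
  have h4 := real_inner_le_norm z y
  rw [inv_mul_eq_div, le_div_iff₀ hc]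
  rcases (norm_nonneg z).eq_or_lt with h0 | h0
  · rw [← h0]; simp
  · nlinarith

/-- there is `C > 0` depending only on `H` such that for all `n ≥ 1`,
`P^(n)` is invertible and `‖(P^(n))⁻¹‖₂ ≤ C n^β` with `β = max 1 (2H)`. -/
theorem fgnCov_inv_specNorm_bound (H : ℝ) (hH0 : 0 < H) (hH1 : H < 1) :
    ∃ C : ℝ, 0 < C ∧ ∀ n : ℕ, 1 ≤ n →
      IsUnit (fgnCov H n) ∧
      specNorm (fgnCov H n)⁻¹ ≤ C * (n : ℝ) ^ (max 1 (2 * H)) := by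
  have hI := fgnI_pos H hH0 hH1
  have hpi := Real.pi_pos
  refine ⟨fgnI H * Real.pi ^ 3 / 4, by positivity, fun n hn => ?_⟩
  have hn0 : (0:ℝ) < n := by exact_mod_cast hn
  have key := specNorm_inv_le (fgnCov H n)
    (4 / (Real.pi ^ 3 * fgnI H) * ((n:ℝ) ^ (max 1 (2 * H)))⁻¹) (by positivity) ?_
  · refine ⟨key.1, key.2.trans (le_of_eq ?_)⟩
    field_simp
  intro x
  have h := fgn_form H hH0 hH1 n hn x
  set Q := ∑ i : Fin n, ∑ j : Fin n, x i * x j * (((|(i:ℝ) - (j:ℝ)| + 1) ^ (2 * H) +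
      abs (|(i:ℝ) - (j:ℝ)| - 1) ^ (2 * H) - 2 * |(i:ℝ) - (j:ℝ)| ^ (2 * H)) / 2) with hQ
  have e : dotProduct x (Matrix.mulVec (fgnCov H n) x) = (1 / (n:ℝ)) ^ (2 * H) * Q := by
    rw [hQ, Finset.mul_sum]
    simp only [dotProduct, Matrix.mulVec, fgnCov]
    refine Finset.sum_congr rfl fun i _ => ?_
    rw [Finset.mul_sum, Finset.mul_sum]
    exact Finset.sum_congr rfl fun j _ => by ring
  rw [e]
  have e2 : (1 / (n:ℝ)) ^ (2 * H) = ((n:ℝ) ^ (2 * H))⁻¹ := by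
    rw [one_div, Real.inv_rpow hn0.le]
  rw [Real.rpow_sub hn0] at h
  rw [e2]
  have hp : (0:ℝ) < (n:ℝ) ^ (2 * H) := by positivity
  calc _ = ((n:ℝ) ^ (2 * H))⁻¹ * ((fgnI H)⁻¹ * (4 / Real.pi ^ 3 *
        ((n:ℝ) ^ (2 * H) / (n:ℝ) ^ (max 1 (2 * H))) * ∑ i, x i ^ 2)) := by field_simp
    _ ≤ ((n:ℝ) ^ (2 * H))⁻¹ * ((fgnI H)⁻¹ * (fgnI H * Q)) := by gcongr
    _ = _ := by field_simp
end

section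
/- Let 0 < H < 1/2, let n ≥ 1 be an integer and δ = 1/n. For every u ∈ ℝⁿ, the quadratic form of the fractional Gaussian noise covariance matrix admits the Gagliardo-seminorm representation uᵀ P^(n) u = (H(1−2H)/2) · ∫∫_{ℝ²} (f_u(x) − f_u(y))² / |x−y|^{2−2H} dx dy, where f_u is extended by 0 to all of ℝ. -/
open Matrix MeasureTheory

/-- The step function `f_u = ∑ i u_i 𝟙_{(iδ, (i+1)δ]}` with `δ = 1/n`,
associated with `u ∈ ℝⁿ`, supported in `(0,1]` and extended by `0` to all of `ℝ`. -/
noncomputable def stepFun (n : ℕ) (u : Fin n → ℝ) : ℝ → ℝ :=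
  fun t => ∑ i : Fin n,
    u i * Set.indicator (Set.Ioc ((i : ℝ) * (1 / n)) (((i : ℝ) + 1) * (1 / n))) 1 t


lemma auxA (r : ℝ) (hr : 1 < r) (x b : ℝ) (h : x < b) :
    ∫⁻ y in Set.Ioi b, ENNReal.ofReal (1 / |x - y| ^ r) =
      ENNReal.ofReal ((b - x) ^ (1 - r) / (r - 1)) := by
  have h1 := (measurePreserving_sub_right volume x).setLIntegral_comp_preimage_emb
    (MeasurableEquiv.subRight x).measurableEmbedding
    (fun z => ENNReal.ofReal (z ^ (-r))) (Set.Ioi (b - x))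
  have hpre : (fun y => y - x) ⁻¹' (Set.Ioi (b - x)) = Set.Ioi b := by
    ext y; simp
  rw [hpre] at h1
  have hpos : 0 < b - x := by linarith
  rw [← ofReal_integral_eq_lintegral_ofReal (integrableOn_Ioi_rpow_of_lt (by linarith) hpos),
    integral_Ioi_rpow_of_lt (by linarith) hpos] at h1
  · rw [show (b - x) ^ (1 - r) / (r - 1) = -(b - x) ^ (-r + 1) / (-r + 1) by
      rw [show -r + 1 = -(r - 1) by ring, neg_div_neg_eq, show -(r-1) = 1 - r by ring], ← h1]
    refine setLIntegral_congr_fun measurableSet_Ioi ?_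
    intro y hy
    have hy' : b < y := hy
    simp only
    rw [abs_sub_comm, abs_of_pos (by linarith), Real.rpow_neg (by linarith), one_div]
  · refine (ae_restrict_mem measurableSet_Ioi).mono ?_
    intro z hz
    exact Real.rpow_nonneg (le_of_lt (lt_trans hpos hz)) _

lemma auxB (r : ℝ) (hr : 1 < r) (x a : ℝ) (h : a < x) :
    ∫⁻ y in Set.Iic a, ENNReal.ofReal (1 / |x - y| ^ r) =
      ENNReal.ofReal ((x - a) ^ (1 - r) / (r - 1)) := by
  have h1 := (Measure.measurePreserving_neg (volume : Measure ℝ)).setLIntegral_comp_preimage_emb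
    (MeasurableEquiv.neg ℝ).measurableEmbedding
    (fun y => ENNReal.ofReal (1 / |x - y| ^ r)) (Set.Iic a)
  have hpre : (Neg.neg) ⁻¹' (Set.Iic a) = Set.Ici (-a) := by
    ext y; simp [neg_le]
  rw [hpre, setLIntegral_congr Ioi_ae_eq_Ici.symm] at h1
  rw [← h1, show x - a = -a - (-x) by ring, ← auxA r hr (-x) (-a) (by linarith)]
  refine setLIntegral_congr_fun measurableSet_Ioi ?_
  intro y hy
  simp only
  rw [show x - -y = -(-x - y) by ring, abs_neg]

lemma auxC (r : ℝ) (hr : 1 < r) (hr2 : r < 2) (a b : ℝ) (h : a ≤ b) :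
    ∫⁻ x in Set.Ioc a b, ENNReal.ofReal ((x - a) ^ (1 - r) / (r - 1)) =
      ENNReal.ofReal ((b - a) ^ (2 - r) / ((2 - r) * (r - 1))) := by
  have hi : IntervalIntegrable (fun x => (x - a) ^ (1 - r) / (r - 1)) volume a b := by
    have := (intervalIntegral.intervalIntegrable_rpow' (r := 1 - r) (by linarith)
      (a := 0) (b := b - a)).comp_sub_right a
    simpa using this.div_const (r - 1)
  rw [← ofReal_integral_eq_lintegral_ofReal
    ((intervalIntegrable_iff_integrableOn_Ioc_of_le h).1 hi),
    ← intervalIntegral.integral_of_le h, intervalIntegral.integral_div,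
    intervalIntegral.integral_comp_sub_right (fun z => z ^ (1 - r)) a,
    integral_rpow (Or.inl (by linarith))]
  · rw [sub_self, show 1 - r + 1 = 2 - r by ring, Real.zero_rpow (by linarith), sub_zero, div_div]
  · refine (ae_restrict_mem measurableSet_Ioc).mono ?_
    intro z hz
    exact div_nonneg (Real.rpow_nonneg (by linarith [hz.1]) _) (by linarith)

lemma auxD (r : ℝ) (hr : 1 < r) (hr2 : r < 2) (a b : ℝ) (h : a ≤ b) :
    ∫⁻ x in Set.Ioc a b, ENNReal.ofReal ((b - x) ^ (1 - r) / (r - 1)) =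
      ENNReal.ofReal ((b - a) ^ (2 - r) / ((2 - r) * (r - 1))) := by
  have h1 := (Measure.measurePreserving_neg (volume : Measure ℝ)).setLIntegral_comp_preimage_emb
    (MeasurableEquiv.neg ℝ).measurableEmbedding
    (fun x => ENNReal.ofReal ((b - x) ^ (1 - r) / (r - 1))) (Set.Ioc a b)
  have hpre : (Neg.neg) ⁻¹' (Set.Ioc a b) = Set.Ico (-b) (-a) := by
    ext y; simp [neg_le, and_comm]
  rw [hpre, setLIntegral_congr Ioo_ae_eq_Ico.symm, setLIntegral_congr Ioo_ae_eq_Ioc] at h1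
  rw [← h1, show b - a = -a - (-b) by ring, ← auxC r hr hr2 (-b) (-a) (by linarith)]
  refine setLIntegral_congr_fun measurableSet_Ioc ?_
  intro y hy
  simp only
  rw [show b - -y = y - -b by ring]

lemma auxE (r : ℝ) (hr : 1 < r) (hr2 : r < 2) (a b : ℝ) (h : a ≤ b) :
    ∫⁻ x in Set.Ioc a b, ∫⁻ y in (Set.Ioc a b)ᶜ, ENNReal.ofReal (1 / |x - y| ^ r) =
      ENNReal.ofReal (2 * (b - a) ^ (2 - r) / ((2 - r) * (r - 1))) := by
  have hm : Measurable (fun x => ENNReal.ofReal ((x - a) ^ (1 - r) / (r - 1))) := by fun_prop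
  have hnn : 0 ≤ (b - a) ^ (2 - r) / ((2 - r) * (r - 1)) :=
    div_nonneg (Real.rpow_nonneg (by linarith) _)
      (mul_nonneg (by linarith) (by linarith))
  rw [mul_div_assoc, two_mul, ENNReal.ofReal_add hnn hnn]
  nth_rewrite 1 [← auxC r hr hr2 a b h]
  rw [← auxD r hr hr2 a b h, ← lintegral_add_left hm,
    setLIntegral_congr Ioo_ae_eq_Ioc.symm, setLIntegral_congr Ioo_ae_eq_Ioc.symm]
  refine setLIntegral_congr_fun measurableSet_Ioo ?_
  intro x hx
  have hc : (Set.Ioc a b)ᶜ = Set.Iic a ∪ Set.Ioi b := by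
    ext y; simp only [Set.mem_compl_iff, Set.mem_Ioc, Set.mem_union, Set.mem_Iic, Set.mem_Ioi]
    grind
  simp only
  rw [hc, lintegral_union measurableSet_Ioi, auxA r hr x b hx.2, auxB r hr x a hx.1]
  rw [Set.disjoint_left]
  intro y hy hy'
  have h1 : y ≤ a := hy
  have h2 : b < y := hy'
  linarith

noncomputable def stp (a x : ℝ) : ℝ := if a < x then 1 else 0

noncomputable def Gk (r a b x y : ℝ) : ℝ :=
  ((stp a x - stp a y) - (stp b x - stp b y)) ^ 2 / |x - y| ^ r

lemma stp_meas (a : ℝ) : Measurable (stp a) :=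
  Measurable.ite measurableSet_Ioi measurable_const measurable_const

lemma stp_sub (a b x : ℝ) (h : a ≤ b) :
    stp a x - stp b x = Set.indicator (Set.Ioc a b) 1 x := by
  unfold stp
  by_cases hx : x ∈ Set.Ioc a b
  · rw [Set.indicator_of_mem hx, if_pos hx.1, if_neg (not_lt.2 hx.2)]; simp
  · rw [Set.indicator_of_notMem hx]
    simp only [Set.mem_Ioc] at hx
    split_ifs <;> grind

lemma Gk_ind (r a b x y : ℝ) (h : a ≤ b) : Gk r a b x y =
    (Set.indicator (Set.Ioc a b) 1 x - Set.indicator (Set.Ioc a b) 1 y) ^ 2 / |x - y| ^ r := by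
  rw [Gk, ← stp_sub a b x h, ← stp_sub a b y h]; ring

lemma Gk_nonneg (r a b x y : ℝ) : 0 ≤ Gk r a b x y := by
  unfold Gk; positivity

lemma Gk_meas (r a b : ℝ) : Measurable (fun p : ℝ × ℝ => Gk r a b p.1 p.2) := by
  have := stp_meas a
  have := stp_meas b
  unfold Gk
  fun_prop

lemma auxF (r : ℝ) (hr : 1 < r) (hr2 : r < 2) (a b : ℝ) (h : a ≤ b) :
    ∫⁻ x, ∫⁻ y, ENNReal.ofReal (Gk r a b x y) =
      ENNReal.ofReal (4 * (b - a) ^ (2 - r) / ((2 - r) * (r - 1))) := by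
  have hI : MeasurableSet (Set.Ioc a b) := measurableSet_Ioc
  rw [← lintegral_add_compl _ hI]
  have e1 : ∫⁻ x in Set.Ioc a b, ∫⁻ y, ENNReal.ofReal (Gk r a b x y) =
      ∫⁻ x in Set.Ioc a b, ∫⁻ y in (Set.Ioc a b)ᶜ, ENNReal.ofReal (1 / |x - y| ^ r) := by
    refine setLIntegral_congr_fun hI ?_
    intro x hx
    simp only
    rw [← lintegral_indicator hI.compl]
    refine lintegral_congr fun y => ?_
    rw [Gk_ind r a b x y h, Set.indicator_of_mem hx]
    by_cases hy : y ∈ Set.Ioc a b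
    · rw [Set.indicator_of_mem hy, Set.indicator_of_notMem (by simpa using hy)]; simp
    · rw [Set.indicator_of_notMem hy, Set.indicator_of_mem (by exact hy)]; simp
  have e2 : ∫⁻ x in (Set.Ioc a b)ᶜ, ∫⁻ y, ENNReal.ofReal (Gk r a b x y) =
      ∫⁻ x in (Set.Ioc a b)ᶜ, ∫⁻ y in Set.Ioc a b, ENNReal.ofReal (1 / |x - y| ^ r) := by
    refine setLIntegral_congr_fun hI.compl ?_
    intro x hx
    simp only
    rw [← lintegral_indicator hI]
    refine lintegral_congr fun y => ?_
    rw [Gk_ind r a b x y h, Set.indicator_of_notMem hx]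
    by_cases hy : y ∈ Set.Ioc a b
    · rw [Set.indicator_of_mem hy, Set.indicator_of_mem hy]; simp
    · rw [Set.indicator_of_notMem hy, Set.indicator_of_notMem hy]; simp
  have e4 : ∫⁻ x in (Set.Ioc a b)ᶜ, ∫⁻ y in Set.Ioc a b, ENNReal.ofReal (1 / |x - y| ^ r) =
      ∫⁻ x in Set.Ioc a b, ∫⁻ y in (Set.Ioc a b)ᶜ, ENNReal.ofReal (1 / |x - y| ^ r) := by
    rw [lintegral_lintegral_swap]
    · refine lintegral_congr fun y => lintegral_congr fun x => ?_
      rw [abs_sub_comm]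
    · apply Measurable.aemeasurable
      unfold Function.uncurry
      fun_prop
  have hnn : 0 ≤ 2 * (b - a) ^ (2 - r) / ((2 - r) * (r - 1)) :=
    div_nonneg (mul_nonneg (by norm_num) (Real.rpow_nonneg (by linarith) _))
      (mul_nonneg (by linarith) (by linarith))
  rw [e1, e2, e4, auxE r hr hr2 a b h, ← ENNReal.ofReal_add hnn hnn]
  congr 1; ring

lemma auxG (r : ℝ) (hr : 1 < r) (hr2 : r < 2) (a b : ℝ) :
    ∫⁻ x, ∫⁻ y, ENNReal.ofReal (Gk r a b x y) =
      ENNReal.ofReal (4 * |a - b| ^ (2 - r) / ((2 - r) * (r - 1))) := by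
  rcases le_total a b with h | h
  · rw [auxF r hr hr2 a b h, abs_sub_comm, abs_of_nonneg (by linarith)]
  · rw [abs_of_nonneg (by linarith), ← auxF r hr hr2 b a h]
    refine lintegral_congr fun y => lintegral_congr fun x => ?_
    unfold Gk
    congr 2; ring

lemma Gk_int (r : ℝ) (hr : 1 < r) (hr2 : r < 2) (a b : ℝ) :
    Integrable (fun p : ℝ × ℝ => Gk r a b p.1 p.2) (volume.prod volume) ∧
    ∫ p : ℝ × ℝ, Gk r a b p.1 p.2 ∂(volume.prod volume) =
      4 * |a - b| ^ (2 - r) / ((2 - r) * (r - 1)) := by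
  have hm := Gk_meas r a b
  have hl : ∫⁻ p : ℝ × ℝ, ENNReal.ofReal (Gk r a b p.1 p.2) ∂(volume.prod volume) =
      ENNReal.ofReal (4 * |a - b| ^ (2 - r) / ((2 - r) * (r - 1))) := by
    rw [lintegral_prod _ (by fun_prop), auxG r hr hr2]
  have hnn : 0 ≤ᵐ[(volume.prod volume : Measure (ℝ × ℝ))] fun p : ℝ × ℝ => Gk r a b p.1 p.2 :=
    Filter.Eventually.of_forall fun p => Gk_nonneg _ _ _ _ _
  constructor
  · refine ⟨hm.aestronglyMeasurable, ?_⟩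
    rw [hasFiniteIntegral_iff_ofReal hnn, hl]
    exact ENNReal.ofReal_lt_top
  · rw [integral_eq_lintegral_of_nonneg_ae hnn hm.aestronglyMeasurable, hl,
      ENNReal.toReal_ofReal]
    refine div_nonneg (mul_nonneg (by norm_num) (Real.rpow_nonneg (abs_nonneg _) _))
        (mul_nonneg (by linarith) (by linarith))

lemma expand (r : ℝ) (n : ℕ) (u : Fin n → ℝ) (x y : ℝ) :
    (stepFun n u x - stepFun n u y) ^ 2 / |x - y| ^ r =
      ∑ i : Fin n, ∑ j : Fin n, (u i * u j / 2) *
        (Gk r ((i : ℝ) * (1 / n)) (((j : ℝ) + 1) * (1 / n)) x y +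
         Gk r (((i : ℝ) + 1) * (1 / n)) ((j : ℝ) * (1 / n)) x y -
         Gk r ((i : ℝ) * (1 / n)) ((j : ℝ) * (1 / n)) x y -
         Gk r (((i : ℝ) + 1) * (1 / n)) (((j : ℝ) + 1) * (1 / n)) x y) := by
  have hs : stepFun n u x - stepFun n u y = ∑ i : Fin n, u i *
      ((stp ((i : ℝ) * (1 / n)) x - stp ((i : ℝ) * (1 / n)) y) -
       (stp (((i : ℝ) + 1) * (1 / n)) x - stp (((i : ℝ) + 1) * (1 / n)) y)) := by
    unfold stepFun
    rw [← Finset.sum_sub_distrib]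
    refine Finset.sum_congr rfl fun i _ => ?_
    have hle : (i : ℝ) * (1 / n) ≤ ((i : ℝ) + 1) * (1 / n) := by gcongr; linarith
    rw [← stp_sub _ _ x hle, ← stp_sub _ _ y hle]; ring
  rw [hs, pow_two, Finset.sum_mul_sum, Finset.sum_div]
  refine Finset.sum_congr rfl fun i _ => ?_
  rw [Finset.sum_div]
  refine Finset.sum_congr rfl fun j _ => ?_
  unfold Gk
  ring

lemma scale (H : ℝ) (hH0 : 0 < H) (hH : H < 1 / 2) (n : ℕ) (p q : ℝ) :
    (H * (1 - 2 * H) / 2) * (4 * |p * (1 / n) - q * (1 / n)| ^ (2 * H) / ((2 * H) * (1 - 2 * H)))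
      = (1 / (n : ℝ)) ^ (2 * H) * |p - q| ^ (2 * H) := by
  rw [← sub_mul, abs_mul, abs_of_nonneg (a := 1 / (n : ℝ)) (by positivity),
    Real.mul_rpow (abs_nonneg _) (by positivity)]
  have h12 : 1 - 2 * H ≠ 0 := ne_of_gt (by linarith)
  generalize |p - q| ^ (2 * H) = A
  generalize (1 / (n : ℝ)) ^ (2 * H) = B
  generalize hK : 1 - 2 * H = K at h12
  field_simp
  norm_num

lemma int4 {f g h k : ℝ × ℝ → ℝ} {μ : Measure (ℝ × ℝ)} (hf : Integrable f μ)
    (hg : Integrable g μ) (hh : Integrable h μ) (hk : Integrable k μ) :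
    ∫ p, (f p + g p - h p - k p) ∂μ = ∫ p, f p ∂μ + ∫ p, g p ∂μ - ∫ p, h p ∂μ - ∫ p, k p ∂μ := by
  have h1 : Integrable (fun p => f p + g p) μ := hf.add hg
  have h2 : Integrable (fun p => f p + g p - h p) μ := h1.sub hh
  rw [integral_sub h2 hk, integral_sub h1 hh, integral_add hf hg]

/-- for `0 < H < 1/2`, the quadratic form of the fGn covariance matrix
admits the Gagliardo-seminorm representation
`uᵀ P^(n) u = (H(1−2H)/2) ∫∫_{ℝ²} (f_u(x) − f_u(y))² / |x−y|^{2−2H} dx dy`. -/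
theorem fgnCov_quadratic_form_gagliardo_repr (H : ℝ) (hH0 : 0 < H) (hH : H < 1 / 2)
    (n : ℕ) (hn : 1 ≤ n) (u : Fin n → ℝ) :
    u ⬝ᵥ (fgnCov H n) *ᵥ u =
      (H * (1 - 2 * H) / 2) *
        ∫ x : ℝ, ∫ y : ℝ,
          (stepFun n u x - stepFun n u y) ^ 2 / |x - y| ^ (2 - 2 * H) := by
  have hr : 1 < 2 - 2 * H := by linarith
  have hr2 : 2 - 2 * H < 2 := by linarith
  have hi := fun a b => (Gk_int (2 - 2 * H) hr hr2 a b).1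
  have hv := fun a b => (Gk_int (2 - 2 * H) hr hr2 a b).2
  have hterm : ∀ i j : Fin n, Integrable (fun p : ℝ × ℝ => (u i * u j / 2) *
        (Gk (2 - 2 * H) ((i : ℝ) * (1 / n)) (((j : ℝ) + 1) * (1 / n)) p.1 p.2 +
         Gk (2 - 2 * H) (((i : ℝ) + 1) * (1 / n)) ((j : ℝ) * (1 / n)) p.1 p.2 -
         Gk (2 - 2 * H) ((i : ℝ) * (1 / n)) ((j : ℝ) * (1 / n)) p.1 p.2 -
         Gk (2 - 2 * H) (((i : ℝ) + 1) * (1 / n)) (((j : ℝ) + 1) * (1 / n)) p.1 p.2))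
         (volume.prod volume) := fun i j =>
    ((((hi _ _).add (hi _ _)).sub (hi _ _)).sub (hi _ _)).const_mul _
  simp_rw [expand]
  rw [← integral_prod (fun p : ℝ × ℝ => ∑ i : Fin n, ∑ j : Fin n, (u i * u j / 2) *
        (Gk (2 - 2 * H) ((i : ℝ) * (1 / n)) (((j : ℝ) + 1) * (1 / n)) p.1 p.2 +
         Gk (2 - 2 * H) (((i : ℝ) + 1) * (1 / n)) ((j : ℝ) * (1 / n)) p.1 p.2 -
         Gk (2 - 2 * H) ((i : ℝ) * (1 / n)) ((j : ℝ) * (1 / n)) p.1 p.2 -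
         Gk (2 - 2 * H) (((i : ℝ) + 1) * (1 / n)) (((j : ℝ) + 1) * (1 / n)) p.1 p.2))
      (integrable_finsetSum _ fun i _ => integrable_finsetSum _ fun j _ => hterm i j)]
  rw [integral_finsetSum _ (fun i _ => integrable_finsetSum _ fun j _ => hterm i j)]
  rw [dotProduct, Finset.mul_sum]
  refine Finset.sum_congr rfl fun i _ => ?_
  rw [integral_finsetSum _ (fun j _ => hterm i j), mulVec, dotProduct, Finset.mul_sum,
    Finset.mul_sum]
  refine Finset.sum_congr rfl fun j _ => ?_
  rw [integral_const_mul, int4 (hi _ _) (hi _ _) (hi _ _) (hi _ _),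
    hv, hv, hv, hv]
  have hsc := scale H hH0 hH n
  rw [show 2 - (2 - 2 * H) = 2 * H by ring, show 2 - 2 * H - 1 = 1 - 2 * H by ring]
  have e : (|(i : ℝ) - j| + 1) ^ (2 * H) + abs (|(i : ℝ) - j| - 1) ^ (2 * H) =
      |(i : ℝ) - (j + 1)| ^ (2 * H) + |(i : ℝ) + 1 - j| ^ (2 * H) := by
    rcases le_total (i : ℝ) j with h | h
    · rw [abs_of_nonpos (a := (i : ℝ) - j) (by linarith),
        abs_of_nonpos (a := (i : ℝ) - (j + 1)) (by linarith),
        ← abs_neg ((i : ℝ) + 1 - j)]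
      congr 2
      · ring
      · congr 1; ring
    · rw [abs_of_nonneg (a := (i : ℝ) - j) (by linarith),
        abs_of_nonneg (a := (i : ℝ) + 1 - j) (by linarith), add_comm]
      congr 2
      · congr 1; ring
      · ring
  have h1 := hsc i (j + 1)
  have h2 := hsc (i + 1) j
  have h3 := hsc i j
  have h4 := hsc (i + 1) (j + 1)
  rw [show (i : ℝ) + 1 - (j + 1) = i - j by ring] at h4
  rw [fgnCov, e]
  linear_combination (- (u i * u j / 2)) * (h1 + h2 - h3 - h4)
end

section
/- Let 1/2 < H < 1 and let h, g : ℝ → ℝ be step functions supported in (0,1] (finite linear combinations of indicator functions of subintervals of (0,1], extended by 0 to ℝ). Then ∫₀^∞ (I^{H−1/2} h)(t) · (I^{H−1/2} g)(t) dt = (Γ(2−2H) / (Γ(H−1/2) Γ(3/2−H))) · ∫₀¹∫₀¹ h(s) g(t) |s−t|^{2H−2} ds dt. -/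
open MeasureTheory

/-- A step function supported in `(0,1]`: a finite linear combination of indicator
functions of subintervals of `(0,1]`, extended by `0` to `ℝ`. -/
def IsStepOnUnit (h : ℝ → ℝ) : Prop :=
  ∃ (m : ℕ) (c a b : Fin m → ℝ),
    (∀ k, 0 ≤ a k ∧ a k ≤ b k ∧ b k ≤ 1) ∧
    h = fun t => ∑ k, c k * Set.indicator (Set.Ioc (a k) (b k)) 1 t

/-- The fractional integral of order `γ` of a function vanishing on the negative
reals: `I^γ h (t) = (1/Γ(γ)) ∫₀ᵗ (t−s)^{γ−1} h(s) ds`. -/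
noncomputable def fracInt (γ : ℝ) (h : ℝ → ℝ) (t : ℝ) : ℝ :=
  (1 / Real.Gamma γ) * ∫ s in (0:ℝ)..t, (t - s) ^ (γ - 1) * h s

/-- truncated power kernel -/
noncomputable def fiK (γ : ℝ) (x : ℝ) : ℝ := Set.indicator (Set.Ioi 0) (fun x => x ^ (γ - 1)) x

theorem fiK_nonneg (γ x : ℝ) : 0 ≤ fiK γ x := by
  unfold fiK
  exact Set.indicator_nonneg (fun y hy => Real.rpow_nonneg (le_of_lt hy) _) x

theorem fiK_meas (γ : ℝ) : Measurable (fiK γ) := by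
  unfold fiK
  exact Measurable.indicator (by fun_prop) measurableSet_Ioi

theorem fi_gam {a r : ℝ} (ha : 0 < a) (hr : 0 < r) :
    ∫⁻ t in Set.Ioi (0:ℝ), ENNReal.ofReal (t ^ (a - 1) * Real.exp (-(r * t))) =
      ENNReal.ofReal (r ^ (-a) * Real.Gamma a) := by
  have h1 := Real.integral_rpow_mul_exp_neg_mul_Ioi ha hr
  have h2 : (1 / r) ^ a = r ^ (-a) := by
    rw [one_div, Real.inv_rpow hr.le, Real.rpow_neg hr.le]
  rw [h2] at h1
  have hpos : 0 < r ^ (-a) * Real.Gamma a := mul_pos (Real.rpow_pos_of_pos hr _) (Real.Gamma_pos_of_pos ha)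
  rw [← h1]
  refine (ofReal_integral_eq_lintegral_ofReal ?_ ?_).symm
  · by_contra hc
    rw [integral_undef hc] at h1
    linarith
  · filter_upwards [ae_restrict_mem measurableSet_Ioi] with t ht
    exact mul_nonneg (Real.rpow_nonneg (le_of_lt ht) _) (Real.exp_pos _).le

/-- the constant -/
noncomputable def fiC (γ : ℝ) : ℝ :=
  Real.Gamma γ * Real.Gamma (1 - 2 * γ) / Real.Gamma (1 - γ)

theorem fi_beta {γ d : ℝ} (h0 : 0 < γ) (h1 : γ < 1 / 2) (hd : 0 < d) :
    ∫⁻ v in Set.Ioi (0:ℝ), ENNReal.ofReal (v ^ (γ - 1) * (v + d) ^ (γ - 1)) =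
      ENNReal.ofReal (fiC γ * d ^ (2 * γ - 1)) := by
  have hG : 0 < Real.Gamma (1 - γ) := Real.Gamma_pos_of_pos (by linarith)
  have hGg : 0 < Real.Gamma γ := Real.Gamma_pos_of_pos (by linarith)
  have e1 : ∀ v ∈ Set.Ioi (0:ℝ), ENNReal.ofReal (v ^ (γ - 1) * (v + d) ^ (γ - 1)) =
      ∫⁻ y in Set.Ioi (0:ℝ), ENNReal.ofReal ((Real.Gamma (1 - γ))⁻¹ *
        (v ^ (γ - 1) * (y ^ (-γ) * Real.exp (-((v + d) * y))))) := by
    intro v hv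
    have hv' : (0:ℝ) < v := hv
    have hp : 0 ≤ (Real.Gamma (1 - γ))⁻¹ * v ^ (γ - 1) := by positivity
    have := fi_gam (a := 1 - γ) (r := v + d) (by linarith) (by linarith)
    rw [show (1 - γ - 1) = -γ by ring, show -(1 - γ) = γ - 1 by ring] at this
    simp_rw [← mul_assoc (Real.Gamma (1 - γ))⁻¹]
    simp_rw [ENNReal.ofReal_mul hp]
    rw [lintegral_const_mul _ (by fun_prop), this, ← ENNReal.ofReal_mul hp]
    congr 1
    field_simp
  rw [setLIntegral_congr_fun measurableSet_Ioi e1, lintegral_lintegral_swap]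
  swap
  · refine Measurable.aemeasurable ?_
    unfold Function.uncurry
    fun_prop
  have e2 : ∀ y ∈ Set.Ioi (0:ℝ), (∫⁻ v in Set.Ioi (0:ℝ), ENNReal.ofReal ((Real.Gamma (1 - γ))⁻¹ *
        (v ^ (γ - 1) * (y ^ (-γ) * Real.exp (-((v + d) * y)))))) =
        ENNReal.ofReal ((Real.Gamma (1 - γ))⁻¹ * Real.Gamma γ) *
          ENNReal.ofReal (y ^ ((1 - 2 * γ) - 1) * Real.exp (-(d * y))) := by
    intro y hy
    have hy' : (0:ℝ) < y := hy
    have hp : 0 ≤ (Real.Gamma (1 - γ))⁻¹ * (y ^ (-γ) * Real.exp (-(d * y))) := by positivity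
    have := fi_gam (a := γ) (r := y) h0 hy'
    have e3 : ∀ v : ℝ, (Real.Gamma (1 - γ))⁻¹ *
        (v ^ (γ - 1) * (y ^ (-γ) * Real.exp (-((v + d) * y)))) =
        ((Real.Gamma (1 - γ))⁻¹ * (y ^ (-γ) * Real.exp (-(d * y)))) *
          (v ^ (γ - 1) * Real.exp (-(y * v))) := by
      intro v
      rw [show -((v + d) * y) = -(d * y) + -(y * v) by ring, Real.exp_add]
      ring
    simp_rw [e3, ENNReal.ofReal_mul hp]
    rw [lintegral_const_mul _ (by fun_prop), this, ← ENNReal.ofReal_mul hp,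
      ← ENNReal.ofReal_mul (by positivity)]
    congr 1
    rw [show (1 - 2 * γ) - 1 = -γ + -γ by ring, Real.rpow_add hy']
    ring
  rw [setLIntegral_congr_fun measurableSet_Ioi e2, lintegral_const_mul _ (by fun_prop),
    fi_gam (by linarith) hd, ← ENNReal.ofReal_mul (by positivity)]
  congr 1
  unfold fiC
  rw [show -(1 - 2 * γ) = 2 * γ - 1 by ring]
  field_simp

theorem fiC_nonneg {γ : ℝ} (h0 : 0 < γ) (h1 : γ < 1 / 2) : 0 ≤ fiC γ := by
  have := Real.Gamma_pos_of_pos (show 0 < 1 - γ by linarith)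
  have := Real.Gamma_pos_of_pos h0
  have := Real.Gamma_pos_of_pos (show 0 < 1 - 2 * γ by linarith)
  unfold fiC
  positivity

theorem fi_kerlt {γ s t : ℝ} (h0 : 0 < γ) (h1 : γ < 1 / 2) (hst : s < t) :
    ∫⁻ u, ENNReal.ofReal (fiK γ (u - s) * fiK γ (u - t)) =
      ENNReal.ofReal (fiC γ * |s - t| ^ (2 * γ - 1)) := by
  rw [abs_of_neg (by linarith), ← fi_beta h0 h1 (by linarith : 0 < -(s - t)),
    ← lintegral_indicator measurableSet_Ioi,
    ← lintegral_sub_right_eq_self (Set.indicator (Set.Ioi (0:ℝ)) _) t]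
  refine lintegral_congr fun u => ?_
  unfold fiK
  by_cases hu : t < u
  · rw [Set.indicator_of_mem (by simp; linarith), Set.indicator_of_mem (by simp; linarith),
      Set.indicator_of_mem (by simp; linarith), mul_comm]
    rw [show u - t + -(s - t) = u - s by ring]
  · rw [Set.indicator_of_notMem (a := u - t) (by simp; linarith),
      Set.indicator_of_notMem (a := u - t) (by simp; linarith)]
    simp

theorem fi_kerne {γ s t : ℝ} (h0 : 0 < γ) (h1 : γ < 1 / 2) (hst : s ≠ t) :
    ∫⁻ u, ENNReal.ofReal (fiK γ (u - s) * fiK γ (u - t)) =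
      ENNReal.ofReal (fiC γ * |s - t| ^ (2 * γ - 1)) := by
  rcases lt_or_gt_of_ne hst with h | h
  · exact fi_kerlt h0 h1 h
  · rw [abs_sub_comm, ← fi_kerlt h0 h1 h]
    simp_rw [mul_comm]

theorem fi_kermeas (γ s t : ℝ) : Measurable (fun u => fiK γ (u - s) * fiK γ (u - t)) :=
  ((fiK_meas γ).comp (measurable_id.sub_const s)).mul
    ((fiK_meas γ).comp (measurable_id.sub_const t))

theorem fi_kerint {γ s t : ℝ} (h0 : 0 < γ) (h1 : γ < 1 / 2) (hst : s ≠ t) :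
    Integrable (fun u => fiK γ (u - s) * fiK γ (u - t)) ∧
    ∫ u, fiK γ (u - s) * fiK γ (u - t) = fiC γ * |s - t| ^ (2 * γ - 1) := by
  have hn : ∀ u, 0 ≤ fiK γ (u - s) * fiK γ (u - t) :=
    fun u => mul_nonneg (fiK_nonneg _ _) (fiK_nonneg _ _)
  have hk := fi_kerne h0 h1 hst
  constructor
  · refine ⟨(fi_kermeas γ s t).aestronglyMeasurable, ?_⟩
    rw [hasFiniteIntegral_iff_ofReal (Filter.Eventually.of_forall hn), hk]
    exact ENNReal.ofReal_lt_top
  · rw [integral_eq_lintegral_of_nonneg_ae (Filter.Eventually.of_forall hn)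
      (fi_kermeas γ s t).aestronglyMeasurable, hk, ENNReal.toReal_ofReal]
    exact mul_nonneg (fiC_nonneg h0 h1) (Real.rpow_nonneg (abs_nonneg _) _)

/-- What we use about step functions. -/
structure FiGood (h : ℝ → ℝ) : Prop where
  meas : Measurable h
  bdd : ∃ M, ∀ x, |h x| ≤ M
  supp : ∀ x, x ∉ Set.Ioc (0:ℝ) 1 → h x = 0

theorem IsStepOnUnit.good {h : ℝ → ℝ} (hh : IsStepOnUnit h) : FiGood h := by
  obtain ⟨m, c, a, b, hab, rfl⟩ := hh
  refine ⟨?_, ⟨∑ k, |c k|, ?_⟩, ?_⟩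
  · refine Finset.measurable_sum _ fun k _ => ?_
    exact (measurable_const.indicator measurableSet_Ioc).const_mul (c k)
  · intro x
    refine (Finset.abs_sum_le_sum_abs _ _).trans (Finset.sum_le_sum fun k _ => ?_)
    rw [abs_mul]
    refine mul_le_of_le_one_right (abs_nonneg _) ?_
    by_cases hx : x ∈ Set.Ioc (a k) (b k) <;> simp [hx]
  · intro x hx
    refine Finset.sum_eq_zero fun k _ => ?_
    rw [Set.indicator_of_notMem, mul_zero]
    intro hx'
    obtain ⟨h1, h2, h3⟩ := hab k
    exact hx ⟨lt_of_le_of_lt h1 hx'.1, hx'.2.trans h3⟩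

theorem FiGood.integrable {h : ℝ → ℝ} (hh : FiGood h) : Integrable h := by
  obtain ⟨M, hM⟩ := hh.bdd
  have h1 : IntegrableOn h (Set.Ioc (0:ℝ) 1) :=
    Measure.integrableOn_of_bounded (M := M) (by simp) hh.meas.aestronglyMeasurable
      (Filter.Eventually.of_forall hM)
  refine (integrableOn_iff_integrable_of_support_subset ?_).1 h1
  intro x hx
  by_contra hc
  exact hx (hh.supp x hc)

theorem fi_absint {β : ℝ} (hβ : -1 < β) :
    Integrable (Set.indicator (Set.Ioc (-1:ℝ) 1) (fun x : ℝ => |x| ^ β)) := by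
  rw [integrable_indicator_iff measurableSet_Ioc]
  have h1 : IntervalIntegrable (fun x : ℝ => |x| ^ β) volume 0 1 := by
    refine (intervalIntegral.intervalIntegrable_rpow' hβ).congr ?_
    intro x hx
    rw [Set.uIoc_of_le zero_le_one] at hx
    simp only [abs_of_pos hx.1]
  have h2 : IntervalIntegrable (fun x : ℝ => |x| ^ β) volume (-1) 0 := by
    have := (IntervalIntegrable.iff_comp_neg (f := fun x : ℝ => |x| ^ β)).1 h1
    simpa using this.symm
  exact (intervalIntegrable_iff_integrableOn_Ioc_of_le (by norm_num)).1 (h2.trans h1)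

theorem fi_prodint {β : ℝ} (hβ : -1 < β) {h g : ℝ → ℝ} (hh : FiGood h) (hg : FiGood g) :
    Integrable (fun p : ℝ × ℝ => h p.1 * g p.2 * |p.1 - p.2| ^ β) (volume.prod volume) := by
  have h1 := Integrable.convolution_integrand (ContinuousLinearMap.mul ℝ ℝ) (hg.integrable)
    (fi_absint hβ)
  obtain ⟨M, hM⟩ := hh.bdd
  have h2 := h1.bdd_mul (f := fun p : ℝ × ℝ => h p.1) (c := M)
    (hh.meas.comp measurable_fst).aestronglyMeasurable (Filter.Eventually.of_forall fun p => hM _)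
  refine h2.congr (Filter.Eventually.of_forall fun p => ?_)
  simp only [ContinuousLinearMap.mul_apply']
  by_cases hp : p.1 ∈ Set.Ioc (0:ℝ) 1
  · by_cases hq : p.2 ∈ Set.Ioc (0:ℝ) 1
    · rw [Set.indicator_of_mem]
      · ring
      · obtain ⟨a, b⟩ := hp
        obtain ⟨c, d⟩ := hq
        constructor <;> linarith
    · simp [hg.supp _ hq]
  · simp [hh.supp _ hp]

theorem fi_ne_ae : ∀ᵐ p : ℝ × ℝ ∂(volume.prod volume), p.1 ≠ p.2 := by
  rw [Measure.ae_prod_iff_ae_ae]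
  · refine Filter.Eventually.of_forall fun x => ?_
    have : ∀ᵐ y : ℝ ∂volume, y ≠ x := by simp [ae_iff]
    filter_upwards [this] with y hy using hy.symm
  · exact (measurableSet_eq_fun measurable_fst measurable_snd).compl

theorem fi_triple {γ : ℝ} (h0 : 0 < γ) (h1 : γ < 1 / 2) {h g : ℝ → ℝ} (hh : FiGood h)
    (hg : FiGood g) :
    Integrable (Function.uncurry fun (p : ℝ × ℝ) (u : ℝ) =>
      (fiK γ (u - p.1) * h p.1) * (fiK γ (u - p.2) * g p.2))
      ((volume.prod volume).prod volume) := by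
  have hK := fiK_meas γ
  have hhm := hh.meas
  have hgm := hg.meas
  rw [integrable_prod_iff]
  · simp only [Function.uncurry]
    constructor
    · filter_upwards [fi_ne_ae] with p hp
      refine ((fi_kerint h0 h1 hp).1.const_mul (h p.1 * g p.2)).congr
        (Filter.Eventually.of_forall fun u => ?_)
      ring
    · have := (fi_prodint (β := 2 * γ - 1) (by linarith) hh hg).norm.const_mul (fiC γ)
      refine this.congr ?_
      filter_upwards [fi_ne_ae] with p hp
      have e : ∀ u, ‖fiK γ (u - p.1) * h p.1 * (fiK γ (u - p.2) * g p.2)‖ =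
          |h p.1 * g p.2| * (fiK γ (u - p.1) * fiK γ (u - p.2)) := by
        intro u
        rw [Real.norm_eq_abs, abs_mul, abs_mul, abs_mul, abs_mul, abs_of_nonneg (fiK_nonneg _ _),
          abs_of_nonneg (fiK_nonneg _ _)]
        ring
      simp_rw [e]
      rw [integral_const_mul, (fi_kerint h0 h1 hp).2, norm_mul,
        Real.norm_of_nonneg (Real.rpow_nonneg (abs_nonneg _) _), Real.norm_eq_abs]
      ring
  · refine Measurable.aestronglyMeasurable ?_
    unfold Function.uncurry
    fun_prop

theorem fi_main {γ : ℝ} (h0 : 0 < γ) (h1 : γ < 1 / 2) {h g : ℝ → ℝ} (hh : FiGood h)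
    (hg : FiGood g) :
    ∫ u, (∫ s, fiK γ (u - s) * h s) * (∫ t, fiK γ (u - t) * g t) =
      fiC γ * ∫ s, ∫ t, h s * g t * |s - t| ^ (2 * γ - 1) := by
  have e := integral_integral_swap (fi_triple h0 h1 hh hg)
  have e1 : ∀ u, (∫ s, fiK γ (u - s) * h s) * (∫ t, fiK γ (u - t) * g t) =
      ∫ p : ℝ × ℝ, (fiK γ (u - p.1) * h p.1) * (fiK γ (u - p.2) * g p.2)
        ∂(volume.prod volume) := by
    intro u
    rw [← integral_prod_mul]
  simp_rw [e1]
  rw [← e, ← integral_prod _ (fi_prodint (by linarith) hh hg), ← integral_const_mul]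
  refine integral_congr_ae ?_
  filter_upwards [fi_ne_ae] with p hp
  rw [mul_left_comm, ← (fi_kerint h0 h1 hp).2, ← integral_const_mul]
  refine integral_congr_ae (Filter.Eventually.of_forall fun u => ?_)
  simp only
  ring

theorem fi_fracInt {γ : ℝ} {h : ℝ → ℝ} (hh : FiGood h) {u : ℝ} (hu : 0 < u) :
    fracInt γ h u = (1 / Real.Gamma γ) * ∫ s, fiK γ (u - s) * h s := by
  unfold fracInt
  congr 1
  rw [intervalIntegral.integral_of_le hu.le, integral_Ioc_eq_integral_Ioo,
    ← setIntegral_eq_integral_of_forall_compl_eq_zero (s := Set.Ioo 0 u)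
      (f := fun s => fiK γ (u - s) * h s)]
  · refine setIntegral_congr_fun measurableSet_Ioo fun s hs => ?_
    have := hs.2
    simp only [fiK]
    rw [Set.indicator_of_mem (by simp; linarith)]
  · intro s hs
    by_cases h1 : 0 < s
    · have : u ≤ s := by
        by_contra hc
        exact hs ⟨h1, by linarith⟩
      unfold fiK
      rw [Set.indicator_of_notMem (by simp; linarith), zero_mul]
    · rw [hh.supp s (fun h2 => h1 h2.1), mul_zero]

theorem fi_zero {γ : ℝ} {h : ℝ → ℝ} (hh : FiGood h) {u : ℝ} (hu : u ≤ 0) (s : ℝ) :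
    fiK γ (u - s) * h s = 0 := by
  by_cases hs : s ∈ Set.Ioc (0:ℝ) 1
  · unfold fiK
    have := hs.1
    rw [Set.indicator_of_notMem (by simp; linarith), zero_mul]
  · rw [hh.supp s hs, mul_zero]

/-- for `1/2 < H < 1` and step functions `h, g` supported in `(0,1]`,
`∫₀^∞ I^{H−1/2}h(t) · I^{H−1/2}g(t) dt
  = (Γ(2−2H)/(Γ(H−1/2)Γ(3/2−H))) ∫₀¹∫₀¹ h(s) g(t) |s−t|^{2H−2} ds dt`. -/
theorem fracInt_inner_product_repr (H : ℝ) (hH : 1 / 2 < H) (hH1 : H < 1)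
    (h g : ℝ → ℝ) (hh : IsStepOnUnit h) (hg : IsStepOnUnit g) :
    ∫ t in Set.Ioi (0:ℝ), fracInt (H - 1 / 2) h t * fracInt (H - 1 / 2) g t =
      (Real.Gamma (2 - 2 * H) / (Real.Gamma (H - 1 / 2) * Real.Gamma (3 / 2 - H))) *
        ∫ s in (0:ℝ)..1, ∫ t in (0:ℝ)..1, h s * g t * |s - t| ^ (2 * H - 2) := by
  have h0 : 0 < H - 1 / 2 := by linarith
  have h1 : H - 1 / 2 < 1 / 2 := by linarith
  have hh' := hh.good
  have hg' := hg.good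
  have key := fi_main h0 h1 hh' hg'
  have e1 : ∫ t in Set.Ioi (0:ℝ), fracInt (H - 1 / 2) h t * fracInt (H - 1 / 2) g t =
      (1 / Real.Gamma (H - 1 / 2)) ^ 2 *
      ∫ u, (∫ s, fiK (H - 1 / 2) (u - s) * h s) * (∫ t, fiK (H - 1 / 2) (u - t) * g t) := by
    rw [← setIntegral_eq_integral_of_forall_compl_eq_zero (s := Set.Ioi (0:ℝ))
      (f := fun u => (∫ s, fiK (H - 1 / 2) (u - s) * h s) * (∫ t, fiK (H - 1 / 2) (u - t) * g t)),
      ← integral_const_mul]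
    · refine setIntegral_congr_fun measurableSet_Ioi fun u hu => ?_
      rw [fi_fracInt hh' hu, fi_fracInt hg' hu]
      ring
    · intro u hu
      simp only [fi_zero hh' (not_lt.1 hu), integral_zero, zero_mul]
  have e2 : ∫ s in (0:ℝ)..1, ∫ t in (0:ℝ)..1, h s * g t * |s - t| ^ (2 * H - 2) =
      ∫ s, ∫ t, h s * g t * |s - t| ^ (2 * (H - 1 / 2) - 1) := by
    rw [show 2 * (H - 1 / 2) - 1 = 2 * H - 2 by ring]
    have e3 : ∀ s, ∫ t in (0:ℝ)..1, h s * g t * |s - t| ^ (2 * H - 2) =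
        ∫ t, h s * g t * |s - t| ^ (2 * H - 2) := by
      intro s
      rw [intervalIntegral.integral_of_le zero_le_one]
      refine setIntegral_eq_integral_of_forall_compl_eq_zero fun t ht => ?_
      rw [hg'.supp t ht, mul_zero, zero_mul]
    simp_rw [e3]
    rw [intervalIntegral.integral_of_le zero_le_one]
    refine setIntegral_eq_integral_of_forall_compl_eq_zero fun s hs => ?_
    simp [hh'.supp s hs]
  rw [e1, e2, key, ← mul_assoc]
  congr 1
  have hG := Real.Gamma_pos_of_pos h0
  unfold fiC
  rw [show 1 - 2 * (H - 1 / 2) = 2 - 2 * H by ring, show 1 - (H - 1 / 2) = 3 / 2 - H by ring]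
  have hG2 := Real.Gamma_pos_of_pos (show 0 < 3 / 2 - H by linarith)
  field_simp
end

section
/- Let 1/2 < H < 1 and let h, g : ℝ → ℝ be step functions supported in (0,1] (extended by 0 to ℝ). Then |∫₀^∞ h(t) g(t) dt| ≤ √c_H · ‖h‖_H · ‖D₋^{H−1/2} g‖_{L²(ℝ₊)}. In particular, taking h = g, ∫₀¹ h(t)² dt ≤ √c_H · ‖h‖_H · ‖D₋^{H−1/2} h‖_{L²(ℝ₊)}. -/
open MeasureTheory

/-- The Marchaud fractional derivative of order `γ`:
`D₋^γ h (t) = −(γ/Γ(1−γ)) ∫_t^∞ (s−t)^{−γ−1}(h(s)−h(t)) ds`. -/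
noncomputable def marchaudDeriv (γ : ℝ) (h : ℝ → ℝ) (t : ℝ) : ℝ :=
  -(γ / Real.Gamma (1 - γ)) * ∫ s in Set.Ioi t, (s - t) ^ (-γ - 1) * (h s - h t)

/-- The inner product `⟨h,g⟩_H = H(2H−1) ∫₀¹∫₀¹ |s−t|^{2H−2} h(s)g(t) ds dt`. -/
noncomputable def innerH (H : ℝ) (h g : ℝ → ℝ) : ℝ :=
  H * (2 * H - 1) * ∫ s in (0:ℝ)..1, ∫ t in (0:ℝ)..1, |s - t| ^ (2 * H - 2) * h s * g t

/-- The norm `‖h‖_H = ⟨h,h⟩_H^{1/2}`. -/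
noncomputable def normH (H : ℝ) (h : ℝ → ℝ) : ℝ :=
  Real.sqrt (innerH H h h)

/-- The `L²(ℝ₊)` norm of a function. -/
noncomputable def l2NormPos (f : ℝ → ℝ) : ℝ :=
  Real.sqrt (∫ t in Set.Ioi (0:ℝ), (f t) ^ 2)

/-- The constant `c_H = Γ(2−2H)Γ(1−H)/(H(2H−1)Γ(3/2−H)Γ(H−1/2))`. -/
noncomputable def cH (H : ℝ) : ℝ :=
  Real.Gamma (2 - 2 * H) * Real.Gamma (1 - H) /
    (H * (2 * H - 1) * Real.Gamma (3 / 2 - H) * Real.Gamma (H - 1 / 2))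


open Set Real ProbabilityTheory

lemma beta01 {α β : ℝ} (hα : 0 < α) (hβ : 0 < β) :
    ∫ x in Ioo (0:ℝ) 1, x ^ (α - 1) * (1 - x) ^ (β - 1) = beta α β := by
  have hb := beta_pos hα hβ
  have h1 : ∫ x, betaPDFReal α β x = 1 := by
    rw [integral_eq_lintegral_of_nonneg_ae]
    · have := lintegral_betaPDF_eq_one hα hβ
      simp only [betaPDF] at this
      rw [this]; simp
    · refine Filter.Eventually.of_forall fun x => ?_
      simp only [Pi.zero_apply, betaPDFReal]
      split_ifs with h
      · have : 0 ≤ 1 - x := by linarith [h.2]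
        have := h.1.le
        positivity
      · exact le_rfl
    · exact (stronglyMeasurable_betaPDFReal α β).aestronglyMeasurable
  have h2 : ∀ x, betaPDFReal α β x =
      (Ioo (0:ℝ) 1).indicator (fun x => (1 / beta α β) * (x ^ (α - 1) * (1 - x) ^ (β - 1))) x := by
    intro x
    simp only [betaPDFReal, indicator, mem_Ioo, mul_assoc]
  simp_rw [h2] at h1
  rw [integral_indicator measurableSet_Ioo, integral_const_mul] at h1
  field_simp at h1
  exact h1

lemma betaA {γ t x : ℝ} (h0 : 0 < γ) (h1 : γ < 1) (htx : t < x) :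
    ∫ u in Ioo t x, (u - t) ^ (γ - 1) * (x - u) ^ (-γ) = beta γ (1 - γ) := by
  have hd : 0 < x - t := by linarith
  have him : (fun w : ℝ => t + (x - t) * w) '' Ioo 0 1 = Ioo t x := by
    ext u
    simp only [mem_image, mem_Ioo]
    constructor
    · rintro ⟨w, ⟨h1, h2⟩, rfl⟩
      constructor <;> nlinarith
    · rintro ⟨h1, h2⟩
      refine ⟨(u - t) / (x - t), ⟨by apply div_pos <;> linarith, ?_⟩, by field_simp; ring⟩
      rw [div_lt_one hd]; linarith
  rw [← him, integral_image_eq_integral_abs_deriv_smul (f' := fun _ => x - t) measurableSet_Ioo]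
  · rw [← beta01 h0 (by linarith : 0 < 1 - γ)]
    refine setIntegral_congr_fun measurableSet_Ioo fun w hw => ?_
    have hw1 : 0 < 1 - w := by linarith [hw.2]
    simp only [smul_eq_mul, abs_of_pos hd]
    rw [show t + (x - t) * w - t = (x - t) * w by ring,
      show x - (t + (x - t) * w) = (x - t) * (1 - w) by ring,
      Real.mul_rpow hd.le hw.1.le, Real.mul_rpow hd.le hw1.le]
    have : (x - t) * ((x - t) ^ (γ - 1) * (x - t) ^ (-γ)) = 1 := by
      rw [← Real.rpow_add hd, show γ - 1 + -γ = -1 by ring, Real.rpow_neg_one]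
      field_simp
    rw [show 1 - γ - 1 = -γ by ring]
    linear_combination (w ^ (γ - 1) * (1 - w) ^ (-γ)) * this
  · intro w _
    have := ((hasDerivAt_id w).const_mul (x - t)).const_add t
    simpa using this.hasDerivWithinAt
  · intro a _ b _ hab
    simpa [hd.ne'] using hab

lemma betaB {γ s t : ℝ} (h0 : 0 < γ) (h1 : γ < 1/2) (hst : s < t) :
    ∫ u in Ioi t, (u - s) ^ (γ - 1) * (u - t) ^ (γ - 1) =
      (t - s) ^ (2 * γ - 1) * beta (1 - 2 * γ) γ := by
  have hd : 0 < t - s := by linarith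
  have him : (fun w : ℝ => s + (t - s) / w) '' Ioo 0 1 = Ioi t := by
    ext u
    simp only [mem_image, mem_Ioo, mem_Ioi]
    constructor
    · rintro ⟨w, ⟨h1, h2⟩, rfl⟩
      have : t - s < (t - s) / w := by rw [lt_div_iff₀ h1]; nlinarith
      linarith
    · intro h1
      have : 0 < u - s := by linarith
      refine ⟨(t - s) / (u - s), ⟨by positivity, ?_⟩, by field_simp; ring⟩
      rw [div_lt_one this]; linarith
  rw [← him, integral_image_eq_integral_abs_deriv_smul (f' := fun w => -(t - s) / w ^ 2)
    measurableSet_Ioo]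
  · rw [← beta01 (by linarith : 0 < 1 - 2 * γ) h0, ← integral_const_mul]
    refine setIntegral_congr_fun measurableSet_Ioo fun w hw => ?_
    have hw0 := hw.1
    have hw1 : 0 < 1 - w := by linarith [hw.2]
    simp only [smul_eq_mul, abs_div, abs_neg, abs_of_pos hd, abs_of_pos (pow_pos hw0 2)]
    rw [show s + (t - s) / w - s = (t - s) * w⁻¹ by field_simp; ring,
      show s + (t - s) / w - t = (t - s) * (w⁻¹ * (1 - w)) by field_simp; ring,
      Real.mul_rpow hd.le (by positivity), Real.mul_rpow hd.le (by positivity),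
      Real.mul_rpow (by positivity) hw1.le, Real.inv_rpow hw0.le]
    have e1 : (t - s) * ((t - s) ^ (γ - 1) * (t - s) ^ (γ - 1)) = (t - s) ^ (2 * γ - 1) := by
      rw [← Real.rpow_add hd]
      nth_rw 1 [← Real.rpow_one (t - s)]
      rw [← Real.rpow_add hd]; congr 1; ring
    have e2 : (w ^ 2)⁻¹ * ((w ^ (γ - 1))⁻¹ * (w ^ (γ - 1))⁻¹) = w ^ (1 - 2 * γ - 1) := by
      rw [← Real.rpow_neg hw0.le, ← Real.rpow_natCast, ← Real.rpow_neg hw0.le,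
        ← Real.rpow_add hw0, ← Real.rpow_add hw0]; congr 1; push_cast; ring
    rw [← e1, ← e2]
    ring
  · intro w hw
    have := ((hasDerivAt_inv hw.1.ne').const_mul (t - s)).const_add s
    refine HasDerivAt.hasDerivWithinAt ?_
    convert! this using 1
    field_simp
  · intro a ha b hb hab
    have := ha.1
    have := hb.1
    simp only [add_right_inj] at hab
    field_simp at hab
    exact hab.symm

/-- the kernel -/
noncomputable def kap (γ v : ℝ) : ℝ := (Ioi (0:ℝ)).indicator (fun v => v ^ (γ - 1)) v

noncomputable def rho (γ x u : ℝ) : ℝ := (Iio x).indicator (fun u => (x - u) ^ (-γ)) u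

lemma kap_nonneg (γ v : ℝ) : 0 ≤ kap γ v :=
  indicator_nonneg (fun _ hv => Real.rpow_nonneg (le_of_lt hv) _) _

lemma rho_nonneg (γ x v : ℝ) : 0 ≤ rho γ x v :=
  indicator_nonneg (fun _ hv => Real.rpow_nonneg (sub_nonneg.2 (le_of_lt hv)) _) _

@[fun_prop]
lemma kap_meas (γ : ℝ) : Measurable (kap γ) :=
  Measurable.indicator (by fun_prop) measurableSet_Ioi

@[fun_prop]
lemma rho_meas (γ x : ℝ) : Measurable (rho γ x) :=
  Measurable.indicator (by fun_prop) measurableSet_Iio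

lemma kap_rho {γ : ℝ} (h0 : 0 < γ) (h1 : γ < 1) (t x : ℝ) :
    Integrable (fun u => kap γ (u - t) * rho γ x u) ∧
    ∫ u, kap γ (u - t) * rho γ x u = (Iio x).indicator (fun _ => beta γ (1 - γ)) t := by
  have key : (fun u => kap γ (u - t) * rho γ x u) =
      (Ioo t x).indicator (fun u => (u - t) ^ (γ - 1) * (x - u) ^ (-γ)) := by
    ext u
    simp only [kap, rho, indicator, mem_Ioi, mem_Iio, mem_Ioo, sub_pos]
    split_ifs <;> simp_all
  rw [key]
  rcases lt_or_ge t x with h | h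
  · have e := betaA h0 h1 h
    have hb : 0 < beta γ (1 - γ) := beta_pos h0 (by linarith)
    constructor
    · rw [integrable_indicator_iff measurableSet_Ioo]
      by_contra hc
      rw [integral_undef hc] at e
      linarith
    · rw [integral_indicator measurableSet_Ioo, e, indicator_of_mem (by exact h)]
  · rw [Ioo_eq_empty (by simpa using h)]
    simp [indicator, h]

lemma kap_kap {γ : ℝ} (h0 : 0 < γ) (h1 : γ < 1/2) {s t : ℝ} (hst : s ≠ t) :
    Integrable (fun u => kap γ (u - s) * kap γ (u - t)) ∧
    ∫ u, kap γ (u - s) * kap γ (u - t) = |s - t| ^ (2 * γ - 1) * beta (1 - 2 * γ) γ := by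
  wlog h : s < t generalizing s t
  · have := this hst.symm (lt_of_le_of_ne (not_lt.1 h) hst.symm)
    simp_rw [mul_comm (kap γ (_ - s)), abs_sub_comm s t]
    exact this
  have key : (fun u => kap γ (u - s) * kap γ (u - t)) =
      (Ioi t).indicator (fun u => (u - s) ^ (γ - 1) * (u - t) ^ (γ - 1)) := by
    ext u
    simp only [kap, indicator, mem_Ioi, sub_pos]
    split_ifs <;> simp_all
    linarith
  rw [key, abs_sub_comm, abs_of_pos (sub_pos.2 h)]
  have e := betaB h0 h1 h
  have hb : 0 < beta (1 - 2 * γ) γ := beta_pos (by linarith) h0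
  have hp : 0 < (t - s) ^ (2 * γ - 1) := Real.rpow_pos_of_pos (sub_pos.2 h) _
  constructor
  · rw [integrable_indicator_iff measurableSet_Ioi]
    by_contra hc
    rw [integral_undef hc] at e
    have := mul_pos hp hb
    linarith
  · rw [integral_indicator measurableSet_Ioi, e]

noncomputable abbrev nu : Measure ℝ := volume.restrict (Ioc (0:ℝ) 1)

lemma abs_rpow_int {r : ℝ} (hr : -1 < r) :
    Integrable ((Ioo (-1:ℝ) 1).indicator (fun x => |x| ^ r)) := by
  have h1 : Integrable ((Ioo (0:ℝ) 1).indicator (fun x => x ^ r)) := by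
    rw [integrable_indicator_iff measurableSet_Ioo]
    have := (intervalIntegral.intervalIntegrable_rpow' (a := 0) (b := 1) hr)
    rw [intervalIntegrable_iff_integrableOn_Ioo_of_le zero_le_one] at this
    exact this
  refine (h1.add h1.comp_neg).congr ?_
  have : ∀ᵐ x : ℝ, x ≠ 0 := Measure.ae_ne volume 0
  filter_upwards [this] with x hx
  simp only [Pi.add_apply, indicator, mem_Ioo]
  rcases lt_or_gt_of_ne hx with h | h
  · have e1 : ¬ (0 < x ∧ x < 1) := by intro h; linarith [h.1]
    rw [if_neg e1, zero_add, abs_of_neg h]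
    congr 1
    simp only [eq_iff_iff]
    constructor <;> rintro ⟨h1, h2⟩ <;> constructor <;> linarith
  · have e1 : ¬ (0 < -x ∧ -x < 1) := by intro h; linarith [h.1]
    rw [if_neg e1, add_zero, abs_of_pos h]
    congr 1
    simp only [eq_iff_iff]
    constructor <;> rintro ⟨h1, h2⟩ <;> constructor <;> linarith

lemma abs_rpow_int2 {r : ℝ} (hr : -1 < r) :
    Integrable (fun y : ℝ × ℝ => |y.1 - y.2| ^ r) (nu.prod nu) := by
  have hf : Integrable (fun _ : ℝ => (1:ℝ)) nu := integrable_const _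
  have := hf.convolution_integrand (ContinuousLinearMap.mul ℝ ℝ) (abs_rpow_int hr)
  have h2 : Integrable (fun p : ℝ × ℝ =>
      (Ioo (-1:ℝ) 1).indicator (fun x => |x| ^ r) (p.1 - p.2)) (nu.prod nu) := by
    refine (Integrable.mono_measure (μ := nu.prod nu) this ?_).congr ?_
    · exact Measure.prod_mono Measure.restrict_le_self le_rfl
    · refine Filter.Eventually.of_forall fun p => ?_
      simp
  refine h2.congr ?_
  rw [Measure.prod_restrict]
  filter_upwards [ae_restrict_mem (measurableSet_Ioc.prod measurableSet_Ioc)] with y hy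
  obtain ⟨⟨h1, h2⟩, h3, h4⟩ := hy
  rw [indicator_of_mem]
  constructor <;> linarith

lemma ae_ne_prod : ∀ᵐ y ∂(nu.prod nu), y.1 ≠ y.2 := by
  rw [ae_iff]
  simp only [ne_eq, not_not]
  rw [Measure.measure_prod_null (measurableSet_eq_fun measurable_fst measurable_snd)]
  refine Filter.Eventually.of_forall fun x => ?_
  have : Prod.mk x ⁻¹' {a : ℝ × ℝ | a.1 = a.2} = {x} := by
    ext z; simp [eq_comm]
  show nu (Prod.mk x ⁻¹' {a : ℝ × ℝ | a.1 = a.2}) = 0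
  rw [this]
  simp

/-- Riemann–Liouville type integral -/
noncomputable def Fab (γ : ℝ) (h : ℝ → ℝ) (u : ℝ) : ℝ := ∫ t, kap γ (u - t) * h t ∂nu

lemma Fab_sq {γ C : ℝ} (h0 : 0 < γ) (h1 : γ < 1/2) {h : ℝ → ℝ} (hm : Measurable h)
    (hC : ∀ t, |h t| ≤ C) :
    Integrable (fun u => Fab γ h u ^ 2) ∧
    ∫ u, Fab γ h u ^ 2 = beta (1 - 2 * γ) γ *
      ∫ s, ∫ t, |s - t| ^ (2 * γ - 1) * h s * h t ∂nu ∂nu := by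
  set Φ : ℝ × (ℝ × ℝ) → ℝ := fun p =>
    (kap γ (p.1 - p.2.1) * kap γ (p.1 - p.2.2)) * (h p.2.1 * h p.2.2) with hΦ
  have hmΦ : Measurable Φ := by rw [hΦ]; fun_prop
  have hint0 : ∀ b : ℝ × ℝ → ℝ, Measurable b → (∃ C, ∀ y, |b y| ≤ C) →
      Integrable (fun y : ℝ × ℝ => (|y.1 - y.2| ^ (2 * γ - 1) * beta (1 - 2 * γ) γ) * b y)
        (nu.prod nu) := by
    rintro b hb ⟨C, hC⟩
    refine Integrable.mul_bdd (c := C) ((abs_rpow_int2 (by linarith)).mul_const _)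
      hb.aestronglyMeasurable ?_
    exact Filter.Eventually.of_forall fun y => hC y
  have hbd : ∀ y : ℝ × ℝ, |h y.1 * h y.2| ≤ C * C := by
    intro y
    rw [abs_mul]
    exact mul_le_mul (hC _) (hC _) (abs_nonneg _) ((abs_nonneg _).trans (hC 0))
  have hI : Integrable Φ (volume.prod (nu.prod nu)) := by
    rw [integrable_prod_iff' hmΦ.aestronglyMeasurable]
    constructor
    · filter_upwards [ae_ne_prod] with y hy
      exact (kap_kap h0 h1 hy).1.mul_const (h y.1 * h y.2)
    · refine (hint0 (fun y => |h y.1 * h y.2|) (by fun_prop) ⟨C * C, ?_⟩).congr ?_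
      · intro y; rw [abs_abs]; exact hbd y
      · filter_upwards [ae_ne_prod] with y hy
        rw [← (kap_kap h0 h1 hy).2, ← integral_mul_const]
        refine integral_congr_ae (Filter.Eventually.of_forall fun u => ?_)
        simp only [hΦ, Real.norm_eq_abs]
        rw [abs_mul (kap γ _ * kap γ _), abs_of_nonneg (mul_nonneg (kap_nonneg _ _) (kap_nonneg _ _))]
  have hF : ∀ u, ∫ y, Φ (u, y) ∂(nu.prod nu) = Fab γ h u ^ 2 := by
    intro u
    rw [Fab, sq, ← integral_prod_mul]
    refine integral_congr_ae (Filter.Eventually.of_forall fun y => ?_)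
    simp only [hΦ]; ring
  constructor
  · have := hI.integral_prod_left
    simpa only [hF] using this
  · have e1 := integral_integral_swap (f := fun u y => Φ (u, y)) hI
    simp only [hF] at e1
    rw [e1]
    have e2 : ∫ y, (∫ u, Φ (u, y)) ∂(nu.prod nu) =
      ∫ y, (|y.1 - y.2| ^ (2 * γ - 1) * beta (1 - 2 * γ) γ) * (h y.1 * h y.2) ∂(nu.prod nu) := by
      refine integral_congr_ae ?_
      filter_upwards [ae_ne_prod] with y hy
      rw [← (kap_kap h0 h1 hy).2, ← integral_mul_const]
    rw [e2, integral_prod _ (hint0 _ (by fun_prop) ⟨_, hbd⟩), ← integral_const_mul]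
    refine integral_congr_ae (Filter.Eventually.of_forall fun s => ?_)
    simp only
    rw [← integral_const_mul]
    refine integral_congr_ae (Filter.Eventually.of_forall fun t => ?_)
    simp only
    ring

lemma Fab_meas {γ : ℝ} {h : ℝ → ℝ} (hm : Measurable h) :
    AEStronglyMeasurable (Fab γ h) volume := by
  have : Measurable (fun p : ℝ × ℝ => kap γ (p.1 - p.2) * h p.2) := by fun_prop
  exact (this.aestronglyMeasurable (μ := volume.prod nu)).integral_prod_right'

lemma Fab_neg {γ : ℝ} {h : ℝ → ℝ} {u : ℝ} (hu : u ≤ 0) : Fab γ h u = 0 := by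
  rw [Fab]
  refine (setIntegral_congr_fun (g := fun _ => (0:ℝ)) measurableSet_Ioc fun t ht => ?_).trans
    (by simp)
  have : ¬ (0 < u - t) := by linarith [ht.1]
  simp [kap, indicator, this]

lemma Fab_rho {γ C : ℝ} (h0 : 0 < γ) (h1 : γ < 1) {h : ℝ → ℝ} (hm : Measurable h)
    (hC : ∀ t, |h t| ≤ C) (x : ℝ) :
    Integrable (fun u => Fab γ h u * rho γ x u) ∧
    ∫ u, Fab γ h u * rho γ x u = beta γ (1 - γ) *
      ∫ t, h t * (Iio x).indicator 1 t ∂nu := by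
  set Θ : ℝ × ℝ → ℝ := fun p => (kap γ (p.1 - p.2) * rho γ x p.1) * h p.2 with hΘ
  have hmΘ : Measurable Θ := by rw [hΘ]; fun_prop
  have hmi : Measurable ((Iio x).indicator (fun _ => beta γ (1 - γ))) :=
    measurable_const.indicator measurableSet_Iio
  have hI : Integrable Θ (volume.prod nu) := by
    rw [integrable_prod_iff' hmΘ.aestronglyMeasurable]
    constructor
    · exact Filter.Eventually.of_forall fun t => (kap_rho h0 h1 t x).1.mul_const (h t)
    · have hh : Integrable (fun _ : ℝ => beta γ (1 - γ) * C) nu := integrable_const _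
      have e : (fun t => ∫ u, ‖Θ (u, t)‖) =
          fun t => (Iio x).indicator (fun _ => beta γ (1 - γ)) t * |h t| := by
        ext t
        rw [← (kap_rho h0 h1 t x).2, ← integral_mul_const]
        refine integral_congr_ae (Filter.Eventually.of_forall fun u => ?_)
        simp only [hΘ, Real.norm_eq_abs]
        rw [abs_mul (kap γ _ * rho γ _ _), abs_of_nonneg (mul_nonneg (kap_nonneg _ _) (rho_nonneg _ _ _))]
      rw [e]
      refine hh.mono' (by fun_prop) (Filter.Eventually.of_forall fun t => ?_)
      have hb : 0 < beta γ (1 - γ) := beta_pos h0 (by linarith)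
      simp only [Real.norm_eq_abs, abs_mul, abs_abs]
      refine mul_le_mul ?_ (hC t) (abs_nonneg _) hb.le
      simp only [indicator]
      split_ifs
      · rw [abs_of_pos hb]
      · simpa using hb.le
  have hF : ∀ u, ∫ t, Θ (u, t) ∂nu = Fab γ h u * rho γ x u := by
    intro u
    rw [Fab, ← integral_mul_const]
    refine integral_congr_ae (Filter.Eventually.of_forall fun y => ?_)
    simp only [hΘ]; ring
  constructor
  · have := hI.integral_prod_left
    simpa only [hF] using this
  · have e1 := integral_integral_swap (f := fun u y => Θ (u, y)) hI
    simp only [hF] at e1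
    rw [e1, ← integral_const_mul]
    refine integral_congr_ae (Filter.Eventually.of_forall fun t => ?_)
    simp only [hΘ]
    rw [integral_mul_const, (kap_rho h0 h1 t x).2]
    simp only [indicator]
    split_ifs <;> simp

lemma rho_memLp {γ : ℝ} (h1 : γ < 1/2) (x : ℝ) :
    MemLp (rho γ x) 2 (volume.restrict (Ioi (0:ℝ))) := by
  rw [memLp_two_iff_integrable_sq (rho_meas γ x).aestronglyMeasurable]
  have h1 : Integrable ((Ioo (0:ℝ) x).indicator (fun v => v ^ (-(2 * γ)))) := by
    rw [integrable_indicator_iff measurableSet_Ioo]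
    rcases le_or_gt x 0 with h | h
    · rw [Ioo_eq_empty (by simpa using h)]; simp
    have := (intervalIntegral.intervalIntegrable_rpow' (a := 0) (b := x)
      (r := -(2 * γ)) (by linarith))
    rw [intervalIntegrable_iff_integrableOn_Ioo_of_le h.le] at this
    exact this
  have h2 := (h1.comp_sub_left x).restrict (s := Ioi (0:ℝ))
  refine h2.congr ?_
  filter_upwards [ae_restrict_mem measurableSet_Ioi] with u hu
  have hu : 0 < u := hu
  simp only [rho, indicator, mem_Ioo, mem_Iio]
  by_cases hx : u < x
  · rw [if_pos hx, if_pos ⟨by linarith, by linarith⟩, ← Real.rpow_natCast, ← Real.rpow_mul (by linarith)]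
    congr 1; push_cast; ring
  · rw [if_neg hx, if_neg (by intro h; apply hx; linarith [h.1])]; simp

lemma step_int {γ t x : ℝ} (h0 : 0 < γ) (htx : t ≠ x) :
    IntegrableOn (fun s => (s - t) ^ (-γ - 1) *
      ((Iic x).indicator 1 s - (Iic x).indicator 1 t)) (Ioi t) ∧
    ∫ s in Ioi t, (s - t) ^ (-γ - 1) *
      ((Iic x).indicator 1 s - (Iic x).indicator 1 t) = -(rho γ x t / γ) := by
  rcases lt_or_gt_of_ne htx with h | h
  · have key : EqOn (fun s => (s - t) ^ (-γ - 1) *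
      ((Iic x).indicator 1 s - (Iic x).indicator 1 t))
      (fun s => (Ioi (x - t)).indicator (fun v => -v ^ (-γ - 1)) (s - t)) (Ioi t) := by
      intro s hs
      simp only [indicator, mem_Ioi, mem_Iic, Pi.one_apply, if_pos h.le]
      rcases le_or_gt s x with h' | h'
      · simp [h']
      · simp [h', not_le.2 h']
    have hsub : ∀ s, s ∉ Ioi t →
        (Ioi (x - t)).indicator (fun v => -v ^ (-γ - 1)) (s - t) = 0 := by
      intro s hs
      simp only [mem_Ioi, not_lt] at hs
      rw [indicator_of_notMem]
      simp only [mem_Ioi, not_lt]; linarith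
    have hi : Integrable ((Ioi (x - t)).indicator (fun v : ℝ => -v ^ (-γ - 1))) := by
      rw [integrable_indicator_iff measurableSet_Ioi]
      exact (integrableOn_Ioi_rpow_of_lt (by linarith) (by linarith)).neg
    constructor
    · rw [integrableOn_congr_fun key measurableSet_Ioi]
      exact (hi.comp_sub_right t).integrableOn
    · rw [setIntegral_congr_fun measurableSet_Ioi key,
        setIntegral_eq_integral_of_forall_compl_eq_zero hsub,
        integral_sub_right_eq_self (fun v => (Ioi (x - t)).indicator (fun v => -v ^ (-γ - 1)) v) t,
        integral_indicator measurableSet_Ioi, integral_neg,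
        integral_Ioi_rpow_of_lt (by linarith) (by linarith), rho, indicator_of_mem (by exact h)]
      rw [show -γ - 1 + 1 = -γ by ring]
      field_simp
  · have key : EqOn (fun s => (s - t) ^ (-γ - 1) *
      ((Iic x).indicator 1 s - (Iic x).indicator 1 t)) (fun _ => 0) (Ioi t) := by
      intro s hs
      have hs : t < s := hs
      simp [indicator, not_le.2 h, not_le.2 (h.trans hs)]
    constructor
    · rw [integrableOn_congr_fun key measurableSet_Ioi]
      exact integrableOn_zero
    · rw [setIntegral_congr_fun measurableSet_Ioi key, rho, indicator_of_notMem]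
      · simp
      · simpa using h.le

lemma ind_Ioc {a b : ℝ} (hab : a ≤ b) (s : ℝ) :
    (Ioc a b).indicator (1 : ℝ → ℝ) s = (Iic b).indicator 1 s - (Iic a).indicator 1 s := by
  simp only [indicator, mem_Ioc, mem_Iic, Pi.one_apply]
  rcases le_or_gt s a with h | h
  · simp [h, h.trans hab, not_lt.2 h]
  · simp [h, not_le.2 h]

lemma marchaud_step {γ : ℝ} (h0 : 0 < γ) {m : ℕ} (c a b : Fin m → ℝ) (hab : ∀ k, a k ≤ b k)
    {t : ℝ} (ht : ∀ k, t ≠ a k ∧ t ≠ b k) :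
    marchaudDeriv γ (fun t => ∑ k, c k * Set.indicator (Set.Ioc (a k) (b k)) 1 t) t =
      ∑ k, (c k / Real.Gamma (1 - γ)) * (rho γ (b k) t - rho γ (a k) t) := by
  rw [marchaudDeriv]
  have e : ∀ s, (s - t) ^ (-γ - 1) * (∑ k, c k * Set.indicator (Set.Ioc (a k) (b k)) 1 s -
      ∑ k, c k * Set.indicator (Set.Ioc (a k) (b k)) 1 t) =
      ∑ k, c k * ((s - t) ^ (-γ - 1) *
      ((Iic (b k)).indicator 1 s - (Iic (b k)).indicator 1 t) - (s - t) ^ (-γ - 1) *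
      ((Iic (a k)).indicator 1 s - (Iic (a k)).indicator 1 t)) := by
    intro s
    rw [← Finset.sum_sub_distrib, Finset.mul_sum]
    refine Finset.sum_congr rfl fun k _ => ?_
    rw [ind_Ioc (hab k), ind_Ioc (hab k)]
    ring
  simp_rw [e]
  rw [integral_finsetSum, Finset.mul_sum]
  · refine Finset.sum_congr rfl fun k _ => ?_
    rw [integral_const_mul, integral_sub (step_int h0 (ht k).2).1 (step_int h0 (ht k).1).1,
      (step_int h0 (ht k).2).2, (step_int h0 (ht k).1).2]
    field_simp
    ring
  · intro k _
    exact ((step_int h0 (ht k).2).1.sub (step_int h0 (ht k).1).1).const_mul _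

lemma cauchy_schwarz {μ : Measure ℝ} {f g : ℝ → ℝ} (hf : MemLp f 2 μ) (hg : MemLp g 2 μ) :
    |∫ u, f u * g u ∂μ| ≤ √(∫ u, f u ^ 2 ∂μ) * √(∫ u, g u ^ 2 ∂μ) := by
  have h2 : (2:ENNReal) = ENNReal.ofReal 2 := by simp
  have := integral_mul_norm_le_Lp_mul_Lq (μ := μ) (f := f) (g := g) Real.HolderConjugate.two_two
    (by rwa [← h2]) (by rwa [← h2])
  refine (abs_integral_le_integral_abs).trans ?_
  simpa [abs_mul, Real.sqrt_eq_rpow] using this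

lemma step_meas {h : ℝ → ℝ} (hh : IsStepOnUnit h) : Measurable h := by
  obtain ⟨m, c, a, b, hab, rfl⟩ := hh
  refine Finset.measurable_sum _ fun k _ => ?_
  exact (measurable_one.indicator measurableSet_Ioc).const_mul _

lemma step_bdd {h : ℝ → ℝ} (hh : IsStepOnUnit h) : ∃ C, ∀ t, |h t| ≤ C := by
  obtain ⟨m, c, a, b, hab, rfl⟩ := hh
  refine ⟨∑ k, |c k|, fun t => ?_⟩
  refine (Finset.abs_sum_le_sum_abs _ _).trans (Finset.sum_le_sum fun k _ => ?_)
  rw [abs_mul]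
  refine mul_le_of_le_one_right (abs_nonneg _) ?_
  simp only [indicator]
  split_ifs <;> simp

lemma step_supp {h : ℝ → ℝ} (hh : IsStepOnUnit h) {t : ℝ} (ht : t ∉ Ioc (0:ℝ) 1) : h t = 0 := by
  obtain ⟨m, c, a, b, hab, rfl⟩ := hh
  refine Finset.sum_eq_zero fun k _ => ?_
  rw [indicator_of_notMem, mul_zero]
  intro h
  exact ht ⟨(hab k).1.trans_lt h.1, h.2.trans (hab k).2.2⟩

lemma step_int_eq {h : ℝ → ℝ} (hh : IsStepOnUnit h) (g : ℝ → ℝ) :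
    ∫ t in Ioi (0:ℝ), h t * g t = ∫ t, h t * g t ∂nu := by
  refine setIntegral_eq_of_subset_of_forall_sdiff_eq_zero measurableSet_Ioi
    Ioc_subset_Ioi_self fun t ht => ?_
  rw [step_supp hh ht.2, zero_mul]

lemma ae_avoid {m : ℕ} (a b : Fin m → ℝ) : ∀ᵐ t : ℝ, ∀ k, t ≠ a k ∧ t ≠ b k := by
  rw [ae_all_iff]
  intro k
  filter_upwards [Measure.ae_ne volume (a k), Measure.ae_ne volume (b k)] with t h1 h2
  exact ⟨h1, h2⟩

lemma pairing {γ : ℝ} (h0 : 0 < γ) (h1 : γ < 1/2) {h g : ℝ → ℝ} (hh : IsStepOnUnit h)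
    (hg : IsStepOnUnit g) :
    MemLp (marchaudDeriv γ g) 2 (volume.restrict (Ioi (0:ℝ))) ∧
    ∫ u in Ioi (0:ℝ), Fab γ h u * marchaudDeriv γ g u =
      Real.Gamma γ * ∫ t in Ioi (0:ℝ), h t * g t := by
  have hm := step_meas hh
  obtain ⟨C, hC⟩ := step_bdd hh
  rw [step_int_eq hh]
  obtain ⟨m, c, a, b, hab, rfl⟩ := hg
  have hD : ∀ᵐ t : ℝ, marchaudDeriv γ
      (fun t => ∑ k, c k * Set.indicator (Set.Ioc (a k) (b k)) 1 t) t =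
      ∑ k, (c k / Real.Gamma (1 - γ)) * (rho γ (b k) t - rho γ (a k) t) := by
    filter_upwards [ae_avoid a b] with t ht
    exact marchaud_step h0 c a b (fun k => (hab k).2.1) ht
  constructor
  · refine (MemLp.ae_eq (f := fun t => ∑ k, (c k / Real.Gamma (1 - γ)) *
      (rho γ (b k) t - rho γ (a k) t)) ?_ ?_ :)
    · filter_upwards [ae_restrict_of_ae hD] with t ht
      exact ht.symm
    · refine memLp_finsetSum Finset.univ fun k _ => ?_
      exact ((rho_memLp h1 (b k)).sub (rho_memLp h1 (a k))).const_mul _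
  · rw [setIntegral_eq_integral_of_forall_compl_eq_zero]
    swap
    · intro u hu
      rw [Fab_neg (by simpa using hu), zero_mul]
    have e1 : ∫ u, Fab γ h u * marchaudDeriv γ
        (fun t => ∑ k, c k * Set.indicator (Set.Ioc (a k) (b k)) 1 t) u =
        ∫ u, ∑ k, (c k / Real.Gamma (1 - γ)) *
          (Fab γ h u * rho γ (b k) u - Fab γ h u * rho γ (a k) u) := by
      refine integral_congr_ae ?_
      filter_upwards [hD] with u hu
      rw [hu, Finset.mul_sum]
      refine Finset.sum_congr rfl fun k _ => ?_
      ring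
    have hR := fun x => Fab_rho h0 (by linarith : γ < 1) hm hC x
    have hi : ∀ x, Integrable (fun t => h t * (Iio x).indicator 1 t) nu := by
      intro x
      have hc : Integrable (fun _ : ℝ => C) nu := integrable_const _
      refine hc.mono' ?_ (Filter.Eventually.of_forall fun t => ?_)
      · exact (hm.mul (measurable_one.indicator measurableSet_Iio)).aestronglyMeasurable
      · simp only [indicator, mem_Iio, Pi.one_apply]
        split_ifs
        · simpa using hC t
        · simpa using (abs_nonneg _).trans (hC t)
    have hi' : ∀ k, Integrable (fun t => c k * (h t * (Iio (b k)).indicator 1 t -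
        h t * (Iio (a k)).indicator 1 t)) nu := fun k => ((hi _).sub (hi _)).const_mul _
    have e2 : ∫ t, h t * ∑ k, c k * Set.indicator (Set.Ioc (a k) (b k)) 1 t ∂nu =
        ∫ t, ∑ k, c k * (h t * (Iio (b k)).indicator 1 t -
        h t * (Iio (a k)).indicator 1 t) ∂nu := by
      refine integral_congr_ae ?_
      filter_upwards [ae_restrict_of_ae (ae_avoid a b)] with t ht
      rw [Finset.mul_sum]
      refine Finset.sum_congr rfl fun k _ => ?_
      rw [ind_Ioc (hab k).2.1]
      have : ∀ x, t ≠ x → (Iic x).indicator (1 : ℝ → ℝ) t = (Iio x).indicator 1 t := by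
        intro x hx
        simp only [indicator, mem_Iic, mem_Iio]
        congr 1
        simp [le_iff_lt_or_eq, hx]
      rw [this _ (ht k).1, this _ (ht k).2]
      ring
    rw [e1, e2, integral_finsetSum _ fun k _ => hi' k, integral_finsetSum, Finset.mul_sum]
    · refine Finset.sum_congr rfl fun k _ => ?_
      rw [integral_const_mul, integral_const_mul, integral_sub (hR _).1 (hR _).1,
        integral_sub (hi _) (hi _), (hR _).2, (hR _).2]
      have hG : Real.Gamma (1 - γ) ≠ 0 := (Real.Gamma_pos_of_pos (by linarith)).ne'
      rw [beta, show γ + (1 - γ) = 1 by ring, Real.Gamma_one]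
      field_simp
    · intro k _
      exact ((hR _).1.sub (hR _).1).const_mul _

lemma main_ineq {H : ℝ} (hH : 1 / 2 < H) (hH1 : H < 1)
    {h g : ℝ → ℝ} (hh : IsStepOnUnit h) (hg : IsStepOnUnit g) :
    |∫ t in Set.Ioi (0:ℝ), h t * g t| ≤
        Real.sqrt (cH H) * normH H h * l2NormPos (marchaudDeriv (H - 1 / 2) g) := by
  have h0 : 0 < H - 1 / 2 := by linarith
  have h1 : H - 1 / 2 < 1 / 2 := by linarith
  obtain ⟨hD, hp⟩ := pairing h0 h1 hh hg
  obtain ⟨C, hC⟩ := step_bdd hh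
  obtain ⟨hFi, hFe⟩ := Fab_sq h0 h1 (step_meas hh) hC
  have hF2 : MemLp (Fab (H - 1 / 2) h) 2 (volume.restrict (Ioi (0:ℝ))) := by
    rw [memLp_two_iff_integrable_sq (Fab_meas (step_meas hh)).restrict]
    exact hFi.restrict
  have hFr : ∫ u in Ioi (0:ℝ), Fab (H - 1 / 2) h u ^ 2 = ∫ u, Fab (H - 1 / 2) h u ^ 2 := by
    refine setIntegral_eq_integral_of_forall_compl_eq_zero fun u hu => ?_
    rw [Fab_neg (by simpa using hu)]; simp
  have cs := cauchy_schwarz hF2 hD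
  have hGp : 0 < Real.Gamma (H - 1 / 2) := Real.Gamma_pos_of_pos h0
  rw [hp, abs_mul, abs_of_pos hGp, hFr, hFe] at cs
  set J := ∫ s, ∫ t, |s - t| ^ (2 * (H - 1 / 2) - 1) * h s * h t ∂nu ∂nu with hJ
  have hB : 0 < beta (1 - 2 * (H - 1 / 2)) (H - 1 / 2) := beta_pos (by linarith) h0
  have hJ0 : 0 ≤ J := by
    have : 0 ≤ beta (1 - 2 * (H - 1 / 2)) (H - 1 / 2) * J := by
      rw [← hFe]; exact integral_nonneg fun u => sq_nonneg _
    exact nonneg_of_mul_nonneg_right this hB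
  have hinner : innerH H h h = H * (2 * H - 1) * J := by
    rw [innerH, hJ]
    simp_rw [intervalIntegral.integral_of_le zero_le_one]
    rw [show 2 * (H - 1 / 2) - 1 = 2 * H - 2 by ring]
  have hG1 : 1 ≤ Real.Gamma (1 - H) := by
    refine Real.Gamma_one.symm.le.trans ?_
    exact Real.Gamma_strictAntiOn_Ioc.antitoneOn ⟨by linarith, by linarith⟩ ⟨by linarith, le_rfl⟩
      (by linarith)
  have hG2 : 0 < Real.Gamma (2 - 2 * H) := Real.Gamma_pos_of_pos (by linarith)
  have hG3 : 0 < Real.Gamma (3 / 2 - H) := Real.Gamma_pos_of_pos (by linarith)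
  have hH2 : 0 < 2 * H - 1 := by linarith
  have hH3 : 0 < H := by linarith
  have key : beta (1 - 2 * (H - 1 / 2)) (H - 1 / 2) * J ≤
      Real.Gamma (H - 1 / 2) ^ 2 * (cH H * innerH H h h) := by
    have : Real.Gamma (H - 1 / 2) ^ 2 * (cH H * innerH H h h) =
        Real.Gamma (1 - H) * (beta (1 - 2 * (H - 1 / 2)) (H - 1 / 2) * J) := by
      rw [hinner, cH, beta, show 1 - 2 * (H - 1 / 2) = 2 - 2 * H by ring,
        show 2 - 2 * H + (H - 1 / 2) = 3 / 2 - H by ring]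
      generalize Real.Gamma (H - 1 / 2) = A at *
      generalize Real.Gamma (2 - 2 * H) = A2 at *
      generalize Real.Gamma (3 / 2 - H) = A3 at *
      generalize Real.Gamma (1 - H) = A4 at *
      generalize 2 * H - 1 = d at *
      field_simp
    rw [this]
    exact le_mul_of_one_le_left (mul_nonneg hB.le hJ0) hG1
  have hc0 : 0 ≤ cH H := by
    have := Real.Gamma_pos_of_pos (by linarith : 0 < 1 - H)
    rw [cH]; positivity
  have hs : √(beta (1 - 2 * (H - 1 / 2)) (H - 1 / 2) * J) ≤
      Real.Gamma (H - 1 / 2) * (√(cH H) * normH H h) := by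
    refine (Real.sqrt_le_sqrt key).trans ?_
    rw [Real.sqrt_mul (sq_nonneg _), Real.sqrt_sq hGp.le, Real.sqrt_mul hc0, normH]
  have fin := cs.trans (mul_le_mul_of_nonneg_right hs (Real.sqrt_nonneg _))
  rw [mul_assoc] at fin
  exact le_of_mul_le_mul_left fin hGp

/-- for `1/2 < H < 1` and step functions `h, g` supported in `(0,1]`,
`|∫₀^∞ h g| ≤ √c_H ‖h‖_H ‖D₋^{H−1/2} g‖_{L²(ℝ₊)}`; in particular, with `h = g`,
`∫₀¹ h² ≤ √c_H ‖h‖_H ‖D₋^{H−1/2} h‖_{L²(ℝ₊)}`. -/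
theorem l2_inner_le_normH_mul_marchaud (H : ℝ) (hH : 1 / 2 < H) (hH1 : H < 1)
    (h g : ℝ → ℝ) (hh : IsStepOnUnit h) (hg : IsStepOnUnit g) :
    |∫ t in Set.Ioi (0:ℝ), h t * g t| ≤
        Real.sqrt (cH H) * normH H h * l2NormPos (marchaudDeriv (H - 1 / 2) g) ∧
      ∫ t in (0:ℝ)..1, (h t) ^ 2 ≤
        Real.sqrt (cH H) * normH H h * l2NormPos (marchaudDeriv (H - 1 / 2) h) := by

  refine ⟨main_ineq hH hH1 hh hg, ?_⟩
  refine le_trans (le_of_eq ?_) ((le_abs_self _).trans (main_ineq hH hH1 hh hh))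
  rw [step_int_eq hh, intervalIntegral.integral_of_le zero_le_one]
  simp_rw [sq]
end

section
/- Let 0 < γ < 1/2. There exists a constant C > 0, depending only on γ, such that for every integer n ≥ 1 and every u ∈ ℝⁿ, Σ_{i=0}^{n−1} Σ_{j₁=i+1}^{n−1} Σ_{j₂=i+1}^{n−1} u_{j₂}² · I(i, j₁, j₂) ≤ C · Σ_{i=0}^{n−1} u_i². -/
open MeasureTheory Finset

/-- `I(i,j₁,j₂) = ∫_i^{i+1} ((j₁+1−s)^{−γ} − (j₁−s)^{−γ})((j₂+1−s)^{−γ} − (j₂−s)^{−γ}) ds`. -/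
noncomputable def Ikernel (γ : ℝ) (i j₁ j₂ : ℕ) : ℝ :=
  ∫ s in (i : ℝ)..((i : ℝ) + 1),
    (((j₁ : ℝ) + 1 - s) ^ (-γ) - ((j₁ : ℝ) - s) ^ (-γ)) *
      (((j₂ : ℝ) + 1 - s) ^ (-γ) - ((j₂ : ℝ) - s) ^ (-γ))

open MeasureTheory Finset

noncomputable def gk (γ : ℝ) (m : ℕ) (t : ℝ) : ℝ :=
  ((m : ℝ) + t) ^ (-γ) - ((m : ℝ) + 1 + t) ^ (-γ)

noncomputable def Kk (γ : ℝ) (a b : ℕ) : ℝ := ∫ t in (0:ℝ)..1, gk γ a t * gk γ b t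

lemma Ikernel_eq_Kk (γ : ℝ) (i a b : ℕ) : Ikernel γ i (i + 1 + a) (i + 1 + b) = Kk γ a b := by
  unfold Ikernel Kk
  have h := intervalIntegral.integral_comp_sub_left (a := (i:ℝ)) (b := (i:ℝ) + 1)
    (fun t => gk γ a t * gk γ b t) ((i:ℝ) + 1)
  have e1 : (i:ℝ) + 1 - ((i:ℝ) + 1) = 0 := by ring
  have e2 : (i:ℝ) + 1 - (i:ℝ) = 1 := by ring
  rw [e1, e2] at h
  rw [← h]
  congr 1
  ext s
  unfold gk
  push_cast
  rw [show (i:ℝ) + 1 + a + 1 - s = a + 1 + (i + 1 - s) by ring,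
    show (i:ℝ) + 1 + b + 1 - s = b + 1 + (i + 1 - s) by ring,
    show (i:ℝ) + 1 + a - s = a + (i + 1 - s) by ring,
    show (i:ℝ) + 1 + b - s = b + (i + 1 - s) by ring]
  ring

lemma gk_nonneg {γ : ℝ} (h0 : 0 < γ) (m : ℕ) {t : ℝ} (ht : 0 < t) : 0 ≤ gk γ m t := by
  unfold gk
  have hm : (0:ℝ) ≤ m := Nat.cast_nonneg m
  have := Real.rpow_le_rpow_of_nonpos (x := (m:ℝ) + t) (y := (m:ℝ) + 1 + t) (z := -γ)
    (by linarith) (by linarith) (by linarith)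
  linarith

lemma sum_gk_le {γ : ℝ} (A : ℕ) {t : ℝ} (ht : 0 < t) :
    ∑ a ∈ range A, gk γ a t ≤ t ^ (-γ) := by
  have h := Finset.sum_range_sub' (fun m : ℕ => ((m : ℝ) + t) ^ (-γ)) A
  have h2 : ∑ a ∈ range A, gk γ a t = (((0:ℕ) : ℝ) + t) ^ (-γ) - ((A : ℝ) + t) ^ (-γ) := by
    rw [← h]
    refine Finset.sum_congr rfl fun a _ => ?_
    unfold gk
    push_cast
    rfl
  rw [h2]
  have : 0 ≤ ((A : ℝ) + t) ^ (-γ) := by positivity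
  simp only [Nat.cast_zero, zero_add]
  linarith

lemma gk_le {γ : ℝ} (h0 : 0 < γ) (m : ℕ) {t : ℝ} (ht : 0 < t) : gk γ m t ≤ t ^ (-γ) :=
  (Finset.single_le_sum (f := fun a => gk γ a t) (fun a _ => gk_nonneg h0 a ht)
    (Finset.self_mem_range_succ m)).trans (sum_gk_le (m + 1) ht)

lemma rpow_mul_self' (γ : ℝ) {t : ℝ} (ht : 0 < t) : t ^ (-γ) * t ^ (-γ) = t ^ (-(2 * γ)) := by
  rw [← Real.rpow_add ht]
  congr 1
  ring

lemma gk_meas (γ : ℝ) (m : ℕ) : Measurable (gk γ m) := by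
  unfold gk
  fun_prop

lemma gk_int {γ : ℝ} (h0 : 0 < γ) (h : γ < 1 / 2) (a b : ℕ) :
    IntervalIntegrable (fun t => gk γ a t * gk γ b t) volume 0 1 := by
  have hi : IntervalIntegrable (fun t : ℝ => t ^ (-(2 * γ))) volume 0 1 :=
    intervalIntegral.intervalIntegrable_rpow' (by linarith)
  refine hi.mono_fun ((gk_meas γ a).mul (gk_meas γ b)).aestronglyMeasurable ?_
  rw [Filter.EventuallyLE, ae_restrict_iff' measurableSet_uIoc]
  refine Filter.Eventually.of_forall fun t ht => ?_
  rw [Set.uIoc_of_le zero_le_one] at ht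
  have ht := ht.1
  rw [Real.norm_of_nonneg (mul_nonneg (gk_nonneg h0 a ht) (gk_nonneg h0 b ht)),
    Real.norm_of_nonneg (by positivity), ← rpow_mul_self' γ ht]
  exact mul_le_mul (gk_le h0 a ht) (gk_le h0 b ht) (gk_nonneg h0 b ht) (by positivity)

lemma Kk_nonneg {γ : ℝ} (h0 : 0 < γ) (a b : ℕ) : 0 ≤ Kk γ a b := by
  unfold Kk
  rw [intervalIntegral.integral_of_le zero_le_one]
  refine setIntegral_nonneg measurableSet_Ioc fun t ht => ?_
  exact mul_nonneg (gk_nonneg h0 a ht.1) (gk_nonneg h0 b ht.1)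

lemma sum_Kk_le {γ : ℝ} (h0 : 0 < γ) (h : γ < 1 / 2) (A B : ℕ) :
    ∑ b ∈ range B, ∑ a ∈ range A, Kk γ a b ≤ 1 / (1 - 2 * γ) := by
  have e : ∑ b ∈ range B, ∑ a ∈ range A, Kk γ a b =
      ∫ t in (0:ℝ)..1, ∑ b ∈ range B, ∑ a ∈ range A, gk γ a t * gk γ b t := by
    rw [intervalIntegral.integral_finsetSum]
    · refine Finset.sum_congr rfl fun b _ => ?_
      rw [intervalIntegral.integral_finsetSum]
      · rfl
      · exact fun a _ => gk_int h0 h a b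
    · intro b _
      have := IntervalIntegrable.sum (range A) (fun a _ => gk_int h0 h a b)
      rw [Finset.sum_fn] at this
      exact this
  have hi : IntervalIntegrable (fun t : ℝ => t ^ (-(2 * γ))) volume 0 1 :=
    intervalIntegral.intervalIntegrable_rpow' (by linarith)
  have v : ∫ t in (0:ℝ)..1, t ^ (-(2 * γ)) = 1 / (1 - 2 * γ) := by
    rw [integral_rpow (Or.inl (by linarith))]
    rw [Real.one_rpow, Real.zero_rpow (by linarith)]
    congr 1 <;> ring
  rw [e, ← v, intervalIntegral.integral_of_le zero_le_one,
    intervalIntegral.integral_of_le zero_le_one]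
  refine integral_mono_of_nonneg ?_ hi.1 ?_
  · rw [Filter.EventuallyLE, ae_restrict_iff' measurableSet_Ioc]
    refine Filter.Eventually.of_forall fun t ht => ?_
    exact Finset.sum_nonneg fun b _ => Finset.sum_nonneg fun a _ =>
      mul_nonneg (gk_nonneg h0 a ht.1) (gk_nonneg h0 b ht.1)
  · rw [Filter.EventuallyLE, ae_restrict_iff' measurableSet_Ioc]
    refine Filter.Eventually.of_forall fun t ht => ?_
    have ht := ht.1
    simp only [← Finset.sum_mul, ← Finset.mul_sum]
    rw [← rpow_mul_self' γ ht]
    exact mul_le_mul (sum_gk_le A ht) (sum_gk_le B ht)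
      (Finset.sum_nonneg fun b _ => gk_nonneg h0 b ht) (by positivity)

/-- for `0 < γ < 1/2` there is `C > 0`, depending only on `γ`, with
`∑_{i=0}^{n−1} ∑_{j₁=i+1}^{n−1} ∑_{j₂=i+1}^{n−1} u_{j₂}² I(i,j₁,j₂) ≤ C ∑_{i=0}^{n−1} uᵢ²`
for all `n ≥ 1` and all `u ∈ ℝⁿ`. -/
theorem Ikernel_sum_uj_bound (γ : ℝ) (hγ0 : 0 < γ) (hγ : γ < 1 / 2) :
    ∃ C : ℝ, 0 < C ∧ ∀ n : ℕ, 1 ≤ n → ∀ u : ℕ → ℝ,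
      ∑ i ∈ range n, ∑ j₁ ∈ Ico (i + 1) n, ∑ j₂ ∈ Ico (i + 1) n,
          u j₂ ^ 2 * Ikernel γ i j₁ j₂ ≤
        C * ∑ i ∈ range n, u i ^ 2 := by
  refine ⟨1 / (1 - 2 * γ), by apply one_div_pos.mpr; linarith, fun n _ u => ?_⟩
  have step : ∀ i ∈ range n, ∑ j₁ ∈ Ico (i + 1) n, ∑ j₂ ∈ Ico (i + 1) n,
      u j₂ ^ 2 * Ikernel γ i j₁ j₂ ≤
      ∑ j ∈ Ico (i + 1) n, u j ^ 2 * ∑ a ∈ range n, Kk γ a (j - 1 - i) := by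
    intro i _
    rw [Finset.sum_comm]
    refine Finset.sum_le_sum fun j hj => ?_
    rw [← Finset.mul_sum]
    refine mul_le_mul_of_nonneg_left ?_ (sq_nonneg _)
    rw [Finset.mem_Ico] at hj
    rw [Finset.sum_Ico_eq_sum_range]
    have hj' : j = i + 1 + (j - 1 - i) := by omega
    calc ∑ k ∈ range (n - (i + 1)), Ikernel γ i (i + 1 + k) j
        = ∑ k ∈ range (n - (i + 1)), Kk γ k (j - 1 - i) := by
          refine Finset.sum_congr rfl fun k _ => ?_
          rw [← Ikernel_eq_Kk γ i k (j - 1 - i), ← hj']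
      _ ≤ _ := Finset.sum_le_sum_of_subset_of_nonneg
          (Finset.range_subset_range.mpr (by omega)) fun a _ _ => Kk_nonneg hγ0 a _
  refine (Finset.sum_le_sum step).trans ?_
  have sw : ∑ i ∈ range n, ∑ j ∈ Ico (i + 1) n, u j ^ 2 * ∑ a ∈ range n, Kk γ a (j - 1 - i)
      = ∑ j ∈ range n, ∑ i ∈ range j, u j ^ 2 * ∑ a ∈ range n, Kk γ a (j - 1 - i) := by
    refine Finset.sum_comm' fun i j => ?_
    simp only [Finset.mem_range, Finset.mem_Ico]
    omega
  rw [sw, Finset.mul_sum]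
  refine Finset.sum_le_sum fun j _ => ?_
  rw [← Finset.mul_sum, mul_comm]
  refine mul_le_mul_of_nonneg_right ?_ (sq_nonneg _)
  rw [Finset.sum_range_reflect (fun b => ∑ a ∈ range n, Kk γ a b) j]
  exact sum_Kk_le hγ0 hγ n j
end

section
/- Let 1/2 < H < 1. There exists a constant C > 0, depending only on H, such that for every integer n ≥ 1, with δ = 1/n, and every u ∈ ℝⁿ, the quadratic form satisfies uᵀ P^(n) u ≥ C · δ^{2H} · Σ_{i=0}^{n−1} u_i². Consequently every eigenvalue of P^(n) is at least C·δ^{2H}, P^(n) is invertible, and ‖(P^(n))^{-1}‖₂ ≤ C^{-1} n^{2H}. -/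
open Matrix MeasureTheory

lemma fgn_integrable (a x : ℝ) (ha : 1 < a) (ha2 : a < 2) :
    IntegrableOn (fun t : ℝ => (1 - Real.cos (x * t)) * t ^ (-1 - a)) (Set.Ioi 0) := by
  have hm : Measurable (fun t : ℝ => (1 - Real.cos (x * t)) * t ^ (-1 - a)) := by fun_prop
  rw [← Set.Ioc_union_Ioi_eq_Ioi (zero_le_one (α := ℝ))]
  refine IntegrableOn.union ?_ ?_
  · have h1 : IntegrableOn (fun t : ℝ => x ^ 2 / 2 * t ^ (1 - a)) (Set.Ioc 0 1) := by
      have := (intervalIntegral.intervalIntegrable_rpow' (a := 0) (b := 1) (r := 1 - a)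
        (by linarith)).const_mul (x ^ 2 / 2)
      rwa [intervalIntegrable_iff_integrableOn_Ioc_of_le zero_le_one] at this
    refine Integrable.mono' h1 hm.aestronglyMeasurable ?_
    refine (ae_restrict_iff' measurableSet_Ioc).2 (Filter.Eventually.of_forall ?_)
    intro t ht
    have ht0 : 0 < t := ht.1
    have hc := Real.cos_le_one (x * t)
    have hc2 := Real.one_sub_sq_div_two_le_cos (x := x * t)
    have hw : 0 < t ^ (-1 - a) := Real.rpow_pos_of_pos ht0 _
    rw [Real.norm_of_nonneg (mul_nonneg (by linarith) hw.le)]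
    have he : t ^ (1 - a) = t ^ 2 * t ^ (-1 - a) := by
      rw [← Real.rpow_natCast t 2, ← Real.rpow_add ht0]
      congr 1; push_cast; ring
    rw [he, ← mul_assoc]
    apply mul_le_mul_of_nonneg_right _ hw.le
    nlinarith
  · have h1 : IntegrableOn (fun t : ℝ => 2 * t ^ (-1 - a)) (Set.Ioi 1) :=
      (integrableOn_Ioi_rpow_of_lt (by linarith) one_pos).const_mul 2
    refine Integrable.mono' h1 hm.aestronglyMeasurable ?_
    refine (ae_restrict_iff' measurableSet_Ioi).2 (Filter.Eventually.of_forall ?_)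
    intro t ht
    have ht0 : 0 < t := lt_trans one_pos ht
    have hc := Real.cos_le_one (x * t)
    have hc2 := Real.neg_one_le_cos (x * t)
    have hw : 0 < t ^ (-1 - a) := Real.rpow_pos_of_pos ht0 _
    rw [Real.norm_of_nonneg (mul_nonneg (by linarith) hw.le)]
    apply mul_le_mul_of_nonneg_right _ hw.le
    linarith

noncomputable def fgnK (a : ℝ) : ℝ :=
  ∫ t in Set.Ioi (0 : ℝ), (1 - Real.cos t) * t ^ (-1 - a)

lemma fgn_scale_s13 (a x : ℝ) (ha : 1 < a) (hx : 0 ≤ x) :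
    ∫ t in Set.Ioi (0 : ℝ), (1 - Real.cos (x * t)) * t ^ (-1 - a) = fgnK a * x ^ a := by
  rcases hx.eq_or_lt with rfl | hx
  · have h0 : a ≠ 0 := by linarith
    simp [Real.zero_rpow h0]
  have h := integral_comp_mul_left_Ioi (fun t : ℝ => (1 - Real.cos t) * t ^ (-1 - a)) 0 hx
  rw [mul_zero, smul_eq_mul] at h
  have h2 : ∫ t in Set.Ioi (0 : ℝ), (1 - Real.cos (x * t)) * (x * t) ^ (-1 - a)
      = x ^ (-1 - a) * ∫ t in Set.Ioi (0 : ℝ), (1 - Real.cos (x * t)) * t ^ (-1 - a) := by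
    rw [← integral_const_mul]
    refine setIntegral_congr_fun measurableSet_Ioi ?_
    intro t ht
    simp only
    rw [Real.mul_rpow hx.le (le_of_lt ht)]
    ring
  rw [h2] at h
  have h3 : x ^ a * x ^ (-1 - a) = x⁻¹ := by
    rw [← Real.rpow_add hx, ← Real.rpow_neg_one]
    congr 1; ring
  have hp : x ^ (-1 - a) ≠ 0 := (Real.rpow_pos_of_pos hx _).ne'
  apply mul_left_cancel₀ hp
  rw [h, ← h3, fgnK]
  ring

lemma fgn_cos_abs_mul (x t : ℝ) : Real.cos (|x| * t) = Real.cos (x * t) := by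
  rcases abs_choice x with h | h <;> rw [h]
  rw [neg_mul, Real.cos_neg]

lemma fgn_integrand (a k t : ℝ) :
    2 * (Real.cos (k * t) * (1 - Real.cos t) * t ^ (-1 - a)) =
      (1 - Real.cos ((|k| + 1) * t)) * t ^ (-1 - a)
      + (1 - Real.cos (|(|k| - 1)| * t)) * t ^ (-1 - a)
      - 2 * ((1 - Real.cos (|k| * t)) * t ^ (-1 - a)) := by
  rw [fgn_cos_abs_mul (|k| - 1) t, ← fgn_cos_abs_mul k t, add_mul, sub_mul (|k|) 1 t,
    Real.cos_add, Real.cos_sub, one_mul]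
  ring

lemma fgn_integrable2 (a k : ℝ) (ha : 1 < a) (ha2 : a < 2) :
    IntegrableOn (fun t : ℝ => Real.cos (k * t) * (1 - Real.cos t) * t ^ (-1 - a))
      (Set.Ioi 0) := by
  have h := (((fgn_integrable a (|k| + 1) ha ha2).add
    (fgn_integrable a (|(|k| - 1)|) ha ha2)).sub
    ((fgn_integrable a (|k|) ha ha2).const_mul 2)).const_mul (1 / 2)
  refine h.congr (Filter.Eventually.of_forall ?_)
  intro t
  have := fgn_integrand a k t
  simp only [Pi.add_apply, Pi.sub_apply]
  linarith

lemma fgn_entry (a k : ℝ) (ha : 1 < a) (ha2 : a < 2) :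
    fgnK a * ((|k| + 1) ^ a + |(|k| - 1)| ^ a - 2 * |k| ^ a) =
      2 * ∫ t in Set.Ioi (0 : ℝ), Real.cos (k * t) * (1 - Real.cos t) * t ^ (-1 - a) := by
  rw [← integral_const_mul]
  simp_rw [fgn_integrand a k]
  have i1 := fgn_integrable a (|k| + 1) ha ha2
  have i2 := fgn_integrable a (|(|k| - 1)|) ha ha2
  have i3 := (fgn_integrable a (|k|) ha ha2).const_mul 2
  have i12 : IntegrableOn (fun t : ℝ => (1 - Real.cos ((|k| + 1) * t)) * t ^ (-1 - a)
      + (1 - Real.cos (|(|k| - 1)| * t)) * t ^ (-1 - a)) (Set.Ioi 0) := i1.add i2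
  rw [integral_sub i12 i3, integral_add i1 i2, integral_const_mul,
    fgn_scale_s13 a _ ha (by positivity), fgn_scale_s13 a _ ha (by positivity),
    fgn_scale_s13 a _ ha (by positivity)]
  ring

lemma fgn_trig (n : ℕ) (u : Fin n → ℝ) (t : ℝ) :
    ∑ i, ∑ j, u i * u j * Real.cos (((i : ℝ) - (j : ℝ)) * t) =
      (∑ i, u i * Real.cos (i * t)) ^ 2 + (∑ i, u i * Real.sin (i * t)) ^ 2 := by
  rw [sq, sq, Finset.sum_mul_sum, Finset.sum_mul_sum, ← Finset.sum_add_distrib]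
  refine Finset.sum_congr rfl fun i _ => ?_
  rw [← Finset.sum_add_distrib]
  refine Finset.sum_congr rfl fun j _ => ?_
  rw [sub_mul, Real.cos_sub]
  ring

lemma fgn_int_cos (k : ℤ) :
    ∫ t in (0 : ℝ)..Real.pi, Real.cos ((k : ℝ) * t) = if k = 0 then Real.pi else 0 := by
  split_ifs with h
  · simp [h]
  · have hk : (k : ℝ) ≠ 0 := by exact_mod_cast h
    rw [intervalIntegral.integral_comp_mul_left (fun t => Real.cos t) hk, integral_cos]
    simp [Real.sin_int_mul_pi]

lemma fgn_parseval (n : ℕ) (u : Fin n → ℝ) :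
    ∫ t in (0 : ℝ)..Real.pi, ∑ i, ∑ j, u i * u j * Real.cos (((i : ℝ) - (j : ℝ)) * t) =
      Real.pi * ∑ i, u i ^ 2 := by
  rw [intervalIntegral.integral_finsetSum
    (fun i _ => Continuous.intervalIntegrable (by fun_prop) _ _), Finset.mul_sum]
  refine Finset.sum_congr rfl fun i _ => ?_
  rw [intervalIntegral.integral_finsetSum
    (fun i _ => Continuous.intervalIntegrable (by fun_prop) _ _)]
  have : ∀ j : Fin n, ∫ t in (0 : ℝ)..Real.pi,
      u i * u j * Real.cos (((i : ℝ) - (j : ℝ)) * t) =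
      if i = j then u i * u j * Real.pi else 0 := by
    intro j
    rw [intervalIntegral.integral_const_mul]
    have h := fgn_int_cos ((i : ℤ) - (j : ℤ))
    push_cast at h
    rw [h]
    have e : ((i : ℤ) - (j : ℤ) = 0) ↔ i = j := by
      rw [Fin.ext_iff]; omega
    simp [e]
  rw [Finset.sum_congr rfl fun j _ => this j]
  simp
  ring

noncomputable def fgnm (a : ℝ) : ℝ := 2 / Real.pi ^ 2 * Real.pi ^ (1 - a)

lemma fgnm_pos (a : ℝ) : 0 < fgnm a := by
  have := Real.pi_pos
  unfold fgnm; positivity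

lemma fgnm_le (a t : ℝ) (ha : 1 < a) (ht : 0 < t) (htp : t ≤ Real.pi) :
    fgnm a ≤ (1 - Real.cos t) * t ^ (-1 - a) := by
  have hc := Real.cos_le_one_sub_mul_cos_sq (x := t) (by rwa [abs_of_pos ht])
  have hw : 0 < t ^ (-1 - a) := Real.rpow_pos_of_pos ht _
  have he : t ^ (1 - a) = t ^ 2 * t ^ (-1 - a) := by
    rw [← Real.rpow_natCast t 2, ← Real.rpow_add ht]
    congr 1; push_cast; ring
  have hmono : Real.pi ^ (1 - a) ≤ t ^ (1 - a) :=
    Real.rpow_le_rpow_of_nonpos ht htp (by linarith)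
  have hp : 0 < 2 / Real.pi ^ 2 := by have := Real.pi_pos; positivity
  calc fgnm a ≤ 2 / Real.pi ^ 2 * t ^ (1 - a) := mul_le_mul_of_nonneg_left hmono hp.le
    _ = (2 / Real.pi ^ 2 * t ^ 2) * t ^ (-1 - a) := by rw [he]; ring
    _ ≤ _ := mul_le_mul_of_nonneg_right (by linarith) hw.le

lemma fgn_main (a : ℝ) (ha : 1 < a) (ha2 : a < 2) (n : ℕ) (u : Fin n → ℝ) :
    fgnm a * Real.pi * ∑ i, u i ^ 2 ≤
      ∑ i, ∑ j, u i * u j * ∫ t in Set.Ioi (0 : ℝ),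
        Real.cos (((i : ℝ) - (j : ℝ)) * t) * (1 - Real.cos t) * t ^ (-1 - a) := by
  set F : ℝ → ℝ := fun t => ∑ i, ∑ j, u i * u j * Real.cos (((i : ℝ) - (j : ℝ)) * t) with hF
  have hF0 : ∀ t, 0 ≤ F t := fun t => by
    simp only [hF]; rw [fgn_trig]; positivity
  have hFc : Continuous F := by fun_prop
  have hi : ∀ i j : Fin n, IntegrableOn (fun t : ℝ => u i * u j *
      (Real.cos (((i : ℝ) - (j : ℝ)) * t) * (1 - Real.cos t) * t ^ (-1 - a))) (Set.Ioi 0) :=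
    fun i j => (fgn_integrable2 a _ ha ha2).const_mul _
  have hfun : ∀ t : ℝ, F t * ((1 - Real.cos t) * t ^ (-1 - a)) = ∑ i, ∑ j, u i * u j *
      (Real.cos (((i : ℝ) - (j : ℝ)) * t) * (1 - Real.cos t) * t ^ (-1 - a)) := by
    intro t
    simp only [hF, Finset.sum_mul]
    refine Finset.sum_congr rfl fun i _ => Finset.sum_congr rfl fun j _ => ?_
    ring
  have hint : IntegrableOn (fun t : ℝ => F t * ((1 - Real.cos t) * t ^ (-1 - a)))
      (Set.Ioi 0) := by
    simp_rw [hfun]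
    exact integrable_finsetSum _ fun i _ => integrable_finsetSum _ fun j _ => hi i j
  have hRHS : ∑ i, ∑ j, u i * u j * ∫ t in Set.Ioi (0 : ℝ),
        Real.cos (((i : ℝ) - (j : ℝ)) * t) * (1 - Real.cos t) * t ^ (-1 - a) =
      ∫ t in Set.Ioi (0 : ℝ), F t * ((1 - Real.cos t) * t ^ (-1 - a)) := by
    simp_rw [hfun]
    rw [integral_finsetSum _ fun i _ => integrable_finsetSum _ fun j _ => hi i j]
    refine Finset.sum_congr rfl fun i _ => ?_
    rw [integral_finsetSum _ fun j _ => hi i j]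
    refine Finset.sum_congr rfl fun j _ => ?_
    rw [integral_const_mul]
  rw [hRHS, mul_assoc, ← fgn_parseval, ← intervalIntegral.integral_const_mul,
    intervalIntegral.integral_of_le Real.pi_pos.le]
  have hsub : Set.Ioc 0 Real.pi ⊆ Set.Ioi (0 : ℝ) := fun t ht => ht.1
  calc ∫ t in Set.Ioc 0 Real.pi, fgnm a * F t
      ≤ ∫ t in Set.Ioc 0 Real.pi, F t * ((1 - Real.cos t) * t ^ (-1 - a)) := by
        refine setIntegral_mono_on ?_ (hint.mono_set hsub) measurableSet_Ioc ?_
        · exact (continuous_const.mul hFc).integrableOn_Ioc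
        · intro t ht
          rw [mul_comm]
          exact mul_le_mul_of_nonneg_left (fgnm_le a t ha ht.1 ht.2) (hF0 t)
    _ ≤ _ := by
        refine setIntegral_mono_set hint ?_ (Filter.Eventually.of_forall hsub)
        refine (ae_restrict_iff' measurableSet_Ioi).2 (Filter.Eventually.of_forall ?_)
        intro t ht
        have := Real.cos_le_one t
        exact mul_nonneg (hF0 t) (mul_nonneg (by linarith) (Real.rpow_nonneg (le_of_lt ht) _))

lemma fgn_main2 (H : ℝ) (hH : 1 / 2 < H) (hH1 : H < 1) (n : ℕ) (u : Fin n → ℝ) :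
    fgnm (2 * H) * Real.pi * (1 / (n : ℝ)) ^ (2 * H) * ∑ i, u i ^ 2 ≤
      fgnK (2 * H) * (u ⬝ᵥ (fgnCov H n) *ᵥ u) := by
  have ha : 1 < 2 * H := by linarith
  have ha2 : 2 * H < 2 := by linarith
  have h := mul_le_mul_of_nonneg_left (fgn_main (2 * H) ha ha2 n u)
    (show 0 ≤ (1 / (n : ℝ)) ^ (2 * H) by positivity)
  have e : fgnK (2 * H) * (u ⬝ᵥ (fgnCov H n) *ᵥ u) = (1 / (n : ℝ)) ^ (2 * H) *
      ∑ i, ∑ j, u i * u j * ∫ t in Set.Ioi (0 : ℝ),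
        Real.cos (((i : ℝ) - (j : ℝ)) * t) * (1 - Real.cos t) * t ^ (-1 - 2 * H) := by
    simp only [dotProduct, mulVec, Finset.mul_sum]
    refine Finset.sum_congr rfl fun i _ => Finset.sum_congr rfl fun j _ => ?_
    have h1 := fgn_entry (2 * H) ((i : ℝ) - (j : ℝ)) ha ha2
    rw [fgnCov]
    linear_combination (u i * u j * (1 / (n : ℝ)) ^ (2 * H) / 2) * h1
  rw [e]
  linarith

lemma fgnK_pos (H : ℝ) (hH : 1 / 2 < H) (hH1 : H < 1) : 0 < fgnK (2 * H) := by
  have h := fgn_main2 H hH hH1 1 (fun _ => 1)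
  have h0 : 2 * H ≠ 0 := by linarith
  have hm := mul_pos (fgnm_pos (2 * H)) Real.pi_pos
  simp [dotProduct, mulVec, fgnCov, Real.zero_rpow h0] at h
  norm_num at h
  linarith

/-- for `1/2 < H < 1` there is `C > 0`, depending only on `H`, such
that for every `n ≥ 1` (with `δ = 1/n`): `uᵀ P^(n) u ≥ C δ^{2H} ∑ uᵢ²` for all
`u ∈ ℝⁿ`; consequently every eigenvalue of `P^(n)` is at least `C δ^{2H}`,
`P^(n)` is invertible, and `‖(P^(n))⁻¹‖₂ ≤ C⁻¹ n^{2H}`. -/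
theorem fgnCov_quadratic_form_lower_bound_large_H (H : ℝ) (hH : 1 / 2 < H) (hH1 : H < 1) :
    ∃ C : ℝ, 0 < C ∧ ∀ n : ℕ, 1 ≤ n →
      (∀ u : Fin n → ℝ,
        C * (1 / (n : ℝ)) ^ (2 * H) * ∑ i, u i ^ 2 ≤ u ⬝ᵥ (fgnCov H n) *ᵥ u) ∧
      (∀ μ : ℝ, Module.End.HasEigenvalue (Matrix.toLin' (fgnCov H n)) μ →
        C * (1 / (n : ℝ)) ^ (2 * H) ≤ μ) ∧
      IsUnit (fgnCov H n) ∧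
      specNorm (fgnCov H n)⁻¹ ≤ C⁻¹ * (n : ℝ) ^ (2 * H) := by
  have hK := fgnK_pos H hH hH1
  have hC : 0 < fgnm (2 * H) * Real.pi / fgnK (2 * H) :=
    div_pos (mul_pos (fgnm_pos _) Real.pi_pos) hK
  refine ⟨fgnm (2 * H) * Real.pi / fgnK (2 * H), hC, ?_⟩
  have hmain : ∀ n : ℕ, ∀ u : Fin n → ℝ,
      fgnm (2 * H) * Real.pi / fgnK (2 * H) * (1 / (n : ℝ)) ^ (2 * H) * ∑ i, u i ^ 2
        ≤ u ⬝ᵥ (fgnCov H n) *ᵥ u := by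
    intro n u
    have h := fgn_main2 H hH hH1 n u
    rw [div_mul_eq_mul_div, div_mul_eq_mul_div, div_le_iff₀ hK]
    linarith
  generalize fgnm (2 * H) * Real.pi / fgnK (2 * H) = C at hC hmain
  intro n hn
  have hn0 : (0 : ℝ) < n := by exact_mod_cast hn
  have hc : 0 < C * (1 / (n : ℝ)) ^ (2 * H) := by positivity
  have hcinv : C⁻¹ * (n : ℝ) ^ (2 * H) = (C * (1 / (n : ℝ)) ^ (2 * H))⁻¹ := by
    rw [mul_inv, one_div, Real.inv_rpow hn0.le, inv_inv]
  have hu := hmain n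
  rw [hcinv]
  generalize C * (1 / (n : ℝ)) ^ (2 * H) = c at hc hu
  generalize fgnCov H n = A at hu
  have hpos : ∀ v : Fin n → ℝ, v ≠ 0 → 0 < ∑ i, v i ^ 2 := by
    intro v hv
    obtain ⟨i, hi⟩ := Function.ne_iff.1 hv
    exact Finset.sum_pos' (fun i _ => sq_nonneg _) ⟨i, Finset.mem_univ _, by
      have : v i ≠ 0 := hi
      positivity⟩
  have hunit : IsUnit A := by
    rw [← Matrix.mulVec_injective_iff_isUnit]
    intro x y hxy
    by_contra hne
    have hp := hpos (x - y) (sub_ne_zero.2 hne)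
    have h := hu (x - y)
    have hxy' : A *ᵥ x = A *ᵥ y := hxy
    rw [Matrix.mulVec_sub, hxy', sub_self, dotProduct_zero] at h
    have := mul_pos hc hp
    linarith
  refine ⟨hu, ?_, hunit, ?_⟩
  · intro μ hμ
    obtain ⟨v, hv⟩ := hμ.exists_hasEigenvector
    have h1 : A *ᵥ v = μ • v := by
      have := hv.apply_eq_smul
      rwa [Matrix.toLin'_apply] at this
    have h := hu v
    rw [h1, dotProduct_smul, smul_eq_mul] at h
    have e : v ⬝ᵥ v = ∑ i, v i ^ 2 := by simp [dotProduct, sq]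
    rw [e] at h
    exact le_of_mul_le_mul_right h (hpos v hv.2)
  · refine ContinuousLinearMap.opNorm_le_bound _ (by positivity) ?_
    intro y
    set x := Matrix.toEuclideanCLM (𝕜 := ℝ) A⁻¹ y with hx
    have hAx : A *ᵥ x.ofLp = y.ofLp := by
      rw [hx, Matrix.ofLp_toEuclideanCLM, Matrix.mulVec_mulVec,
        Matrix.mul_nonsing_inv _ ((Matrix.isUnit_iff_isUnit_det A).1 hunit), Matrix.one_mulVec]
    have h := hu x.ofLp
    rw [hAx, ← EuclideanSpace.real_norm_sq_eq] at h
    have h2 : x.ofLp ⬝ᵥ y.ofLp = inner ℝ y x := by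
      rw [EuclideanSpace.inner_eq_star_dotProduct]; simp
    rw [h2] at h
    have h3 := real_inner_le_norm y x
    rw [inv_mul_eq_div, le_div_iff₀ hc]
    rcases (norm_nonneg x).eq_or_lt with h0 | h0
    · rw [← h0, zero_mul]; exact norm_nonneg y
    · refine le_of_mul_le_mul_right ?_ h0
      nlinarith
end
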